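/- Strong duality for uncertainty quantification under a dual-side Slater condition: under assumptions (G), (C), (H) and (S), if (AD-B') admits a Slater point with λ > 0 (all components strictly positive), then the problems (AP-W'), (AP-W), (D-UQ), (P-UQ), (FR), (AD-B) and (AD-B') all have the same optimal value and (AP-W') is solvable; moreover, if (α*, β*, {y_i^{(0)*}}, {y_{ij}^{(1)*}}, {y_{iℓ}^{(2)*}, ν_{iℓ}*}) solves (AP-W'), then (α*, β*) solves (D-UQ). -/

import Mathlib

noncomputable section
open scoped BigOperators Classical ENNReal
open MeasureTheory

/-- Dot product on `ℝ^n`. -/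
def dotp {n : ℕ} (x y : Fin n → ℝ) : ℝ := ∑ i, x i * y i

/-- The (effective) domain of an extended-real-valued function. -/
def edom {n : ℕ} (f : (Fin n → ℝ) → EReal) : Set (Fin n → ℝ) := {x | f x < ⊤}

/-- `f` is proper: it never takes the value `−∞` and is `< +∞` somewhere. -/
def ProperFn {n : ℕ} (f : (Fin n → ℝ) → EReal) : Prop := (∀ x, f x ≠ ⊥) ∧ (∃ x, f x ≠ ⊤)

/-- `f` is closed: lower semicontinuous, and either nowhere `−∞` or identically `−∞`. -/
def ClosedFn {n : ℕ} (f : (Fin n → ℝ) → EReal) : Prop :=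
  LowerSemicontinuous f ∧ ((∀ x, f x ≠ ⊥) ∨ (∀ x, f x = ⊥))

/-- Convexity of an extended-real-valued function, via convexity of its epigraph. -/
def ConvexFn {n : ℕ} (f : (Fin n → ℝ) → EReal) : Prop :=
  Convex ℝ {p : (Fin n → ℝ) × ℝ | f p.1 ≤ (p.2 : EReal)}

/-- The conjugate `f*(w) = sup_x { wᵀx − f(x) }`. -/
def conjFn {n : ℕ} (f : (Fin n → ℝ) → EReal) (w : Fin n → ℝ) : EReal :=
  ⨆ x : Fin n → ℝ, (((dotp w x : ℝ) : EReal) - f x)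

/-- The support function `δ*_X(w) = sup_{x ∈ X} xᵀw`. -/
def suppFn {n : ℕ} (X : Set (Fin n → ℝ)) (w : Fin n → ℝ) : EReal :=
  ⨆ x ∈ X, ((dotp x w : ℝ) : EReal)

/-- The convex perspective `t f(x/t)` of a proper closed convex function `f`,
equal to `t f(x/t)` for `t > 0` and to `δ*_{dom f*}(x)` for `t = 0`. -/
def persp {n : ℕ} (f : (Fin n → ℝ) → EReal) (x : Fin n → ℝ) (t : ℝ) : EReal :=
  if 0 < t then (t : EReal) * f (t⁻¹ • x) else suppFn (edom (conjFn f)) x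

/-- The concave perspective `t g(x/t)` of a function `g` with `−g` proper, closed and
convex, equal to `t g(x/t)` for `t > 0` and to `−δ*_{dom (−g)*}(x)` for `t = 0`. -/
def cpersp {n : ℕ} (g : (Fin n → ℝ) → EReal) (x : Fin n → ℝ) (t : ℝ) : EReal :=
  if 0 < t then (t : EReal) * g (t⁻¹ • x)
  else - suppFn (edom (conjFn (fun z => - g z))) x

/-- `f` is an affine ("linear") constraint function. -/
def IsAffineFn {n : ℕ} (f : (Fin n → ℝ) → EReal) : Prop :=
  ∃ (a : Fin n → ℝ) (b : ℝ), ∀ x, f x = ((dotp a x + b : ℝ) : EReal)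

/-- Positive part of an extended real number, as an extended non-negative real. -/
def epos (x : EReal) : ℝ≥0∞ := if x = ⊤ then ⊤ else ENNReal.ofReal x.toReal

/-- Expectation `E_P[f(z̃)]` with the convention that it equals `−∞` whenever the
expectations of the positive and negative parts of `f(z̃)` are both infinite
(infeasibility dominates in maximization). -/
def lowExp {n : ℕ} (P : Measure (Fin n → ℝ)) (f : (Fin n → ℝ) → EReal) : EReal :=
  ((∫⁻ z, epos (f z) ∂P : ℝ≥0∞) : EReal) - ((∫⁻ z, epos (-(f z)) ∂P : ℝ≥0∞) : EReal)

/-- Expectation `E_P[f(z̃)]` with the convention that it equals `+∞` whenever the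
expectations of the positive and negative parts of `f(z̃)` are both infinite
(infeasibility dominates in the moment constraints). -/
def highExp {n : ℕ} (P : Measure (Fin n → ℝ)) (f : (Fin n → ℝ) → EReal) : EReal :=
  - lowExp P (fun z => - f z)

variable {dz I J L : ℕ}

/-- Assumption (G): `−g_i` is proper, closed and convex for each `i`. -/
def AssumptionG (gi : Fin I → (Fin dz → ℝ) → EReal) : Prop :=
  ∀ i, ProperFn (fun z => - gi i z) ∧ ClosedFn (fun z => - gi i z) ∧
    ConvexFn (fun z => - gi i z)

/-- Assumption (C): each `c_ℓ` is proper, closed and convex. -/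
def AssumptionC (c : Fin L → (Fin dz → ℝ) → EReal) : Prop :=
  ∀ ℓ, ProperFn (c ℓ) ∧ ClosedFn (c ℓ) ∧ ConvexFn (c ℓ)

/-- Assumption (H): each `h_j` is proper, closed and convex. -/
def AssumptionH (h : Fin J → (Fin dz → ℝ) → EReal) : Prop :=
  ∀ j, ProperFn (h j) ∧ ClosedFn (h j) ∧ ConvexFn (h j)

/-- The support set `S = {z : c_ℓ(z) ≤ 0 ∀ℓ}`. -/
def Sset (c : Fin L → (Fin dz → ℝ) → EReal) : Set (Fin dz → ℝ) :=
  {z | ∀ ℓ, c ℓ z ≤ 0}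

/-- The set `S̄_i = {z ∈ S : z ∈ dom h_j ∀j, z ∈ dom(−g_i)}`. -/
def SbarI (gi : Fin I → (Fin dz → ℝ) → EReal) (c : Fin L → (Fin dz → ℝ) → EReal)
    (h : Fin J → (Fin dz → ℝ) → EReal) (i : Fin I) : Set (Fin dz → ℝ) :=
  {z | z ∈ Sset c ∧ (∀ j, h j z < ⊤) ∧ ⊥ < gi i z}

/-- The effective support set `S̄ = ∪_i S̄_i`. -/
def Sbar (gi : Fin I → (Fin dz → ℝ) → EReal) (c : Fin L → (Fin dz → ℝ) → EReal)
    (h : Fin J → (Fin dz → ℝ) → EReal) : Set (Fin dz → ℝ) :=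
  ⋃ i, SbarI gi c h i

/-- Assumption (S): each `S̄_i` is nonempty. -/
def AssumptionS (gi : Fin I → (Fin dz → ℝ) → EReal)
    (c : Fin L → (Fin dz → ℝ) → EReal) (h : Fin J → (Fin dz → ℝ) → EReal) : Prop :=
  ∀ i, (SbarI gi c h i).Nonempty

/-- The disutility function `g(z) = max_i g_i(z)`. -/
def gFun (gi : Fin I → (Fin dz → ℝ) → EReal) (z : Fin dz → ℝ) : EReal :=
  ⨆ i, gi i z

/-- The ambiguity set `𝒫` of all probability distributions supported on `S`
satisfying the moment conditions `E_P[h_j(z̃)] ≤ μ_j`. -/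
def ambSet (c : Fin L → (Fin dz → ℝ) → EReal) (h : Fin J → (Fin dz → ℝ) → EReal)
    (μ : Fin J → ℝ) : Set (Measure (Fin dz → ℝ)) :=
  {P | IsProbabilityMeasure P ∧ P (Sset c) = 1 ∧
       ∀ j, highExp P (h j) ≤ ((μ j : ℝ) : EReal)}

/-- Optimal value of the primal uncertainty quantification problem (P-UQ). -/
def puqVal (gi : Fin I → (Fin dz → ℝ) → EReal) (c : Fin L → (Fin dz → ℝ) → EReal)
    (h : Fin J → (Fin dz → ℝ) → EReal) (μ : Fin J → ℝ) : EReal :=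
  ⨆ P ∈ {P | P ∈ ambSet c h μ ∧ lowExp P (gFun gi) ≠ ⊥}, lowExp P (gFun gi)

/-- Feasible region of the dual uncertainty quantification problem (D-UQ). -/
def duqFeas (gi : Fin I → (Fin dz → ℝ) → EReal) (c : Fin L → (Fin dz → ℝ) → EReal)
    (h : Fin J → (Fin dz → ℝ) → EReal) : Set (ℝ × (Fin J → ℝ)) :=
  {p | (∀ j, 0 ≤ p.2 j) ∧
       ∀ z ∈ Sbar gi c h, gFun gi z ≤ (p.1 : EReal) + ∑ j, (p.2 j : EReal) * h j z}

/-- Optimal value of the dual uncertainty quantification problem (D-UQ). -/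
def duqVal (gi : Fin I → (Fin dz → ℝ) → EReal) (c : Fin L → (Fin dz → ℝ) → EReal)
    (h : Fin J → (Fin dz → ℝ) → EReal) (μ : Fin J → ℝ) : EReal :=
  ⨅ p ∈ duqFeas gi c h, ((p.1 + dotp μ p.2 : ℝ) : EReal)

/-- (D-UQ) is solvable. -/
def duqSolvable (gi : Fin I → (Fin dz → ℝ) → EReal) (c : Fin L → (Fin dz → ℝ) → EReal)
    (h : Fin J → (Fin dz → ℝ) → EReal) (μ : Fin J → ℝ) : Prop :=
  duqFeas gi c h = ∅ ∨
    ∃ p ∈ duqFeas gi c h, ((p.1 + dotp μ p.2 : ℝ) : EReal) = duqVal gi c h μ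

/-- The augmented support set
`U_i = {(z,u,t) : c_ℓ(z) ≤ 0 ∀ℓ, h(z) ≤ u, g_i(z) ≥ t}`. -/
def Uset {dz I J L : ℕ} (gi : Fin I → (Fin dz → ℝ) → EReal)
    (c : Fin L → (Fin dz → ℝ) → EReal) (h : Fin J → (Fin dz → ℝ) → EReal)
    (i : Fin I) : Set ((Fin dz → ℝ) × (Fin J → ℝ) × ℝ) :=
  {q | (∀ ℓ, c ℓ q.1 ≤ 0) ∧ (∀ j, h j q.1 ≤ ((q.2.1 j : ℝ) : EReal)) ∧
       ((q.2.2 : ℝ) : EReal) ≤ gi i q.1}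

/-- Feasible region of the ambiguous primal worst problem (AP-W): `β ≥ 0` and
`sup_{(z,u,t) ∈ U_i} { t − α − uᵀβ } ≤ 0` for every `i`. -/
def apwFeas {dz I J L : ℕ} (gi : Fin I → (Fin dz → ℝ) → EReal)
    (c : Fin L → (Fin dz → ℝ) → EReal) (h : Fin J → (Fin dz → ℝ) → EReal) :
    Set (ℝ × (Fin J → ℝ)) :=
  {p | (∀ j, 0 ≤ p.2 j) ∧
       ∀ i, ∀ q ∈ Uset gi c h i, q.2.2 - p.1 - dotp q.2.1 p.2 ≤ 0}

/-- Optimal value of the ambiguous primal worst problem (AP-W). -/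
def apwVal {dz I J L : ℕ} (gi : Fin I → (Fin dz → ℝ) → EReal)
    (c : Fin L → (Fin dz → ℝ) → EReal) (h : Fin J → (Fin dz → ℝ) → EReal)
    (μ : Fin J → ℝ) : EReal :=
  ⨅ p ∈ apwFeas gi c h, ((p.1 + dotp μ p.2 : ℝ) : EReal)

/-- (AP-W) is solvable. -/
def apwSolvable {dz I J L : ℕ} (gi : Fin I → (Fin dz → ℝ) → EReal)
    (c : Fin L → (Fin dz → ℝ) → EReal) (h : Fin J → (Fin dz → ℝ) → EReal)
    (μ : Fin J → ℝ) : Prop :=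
  apwFeas gi c h = ∅ ∨
    ∃ p ∈ apwFeas gi c h, ((p.1 + dotp μ p.2 : ℝ) : EReal) = apwVal gi c h μ

/-- Objective of the finite reduction problem (FR): `Σ_i λ_i g(z_i)`. -/
def frObj {dz I : ℕ} (gi : Fin I → (Fin dz → ℝ) → EReal)
    (p : (Fin I → Fin dz → ℝ) × (Fin I → ℝ)) : EReal :=
  ∑ i, ((p.2 i : ℝ) : EReal) * gFun gi (p.1 i)

/-- Feasible region of the finite reduction problem (FR). -/
def frFeas {dz I J L : ℕ} (gi : Fin I → (Fin dz → ℝ) → EReal)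
    (c : Fin L → (Fin dz → ℝ) → EReal) (h : Fin J → (Fin dz → ℝ) → EReal)
    (μ : Fin J → ℝ) : Set ((Fin I → Fin dz → ℝ) × (Fin I → ℝ)) :=
  {p | (∀ i, p.1 i ∈ Sbar gi c h) ∧ (∀ i, 0 ≤ p.2 i) ∧ (∑ i, p.2 i) = 1 ∧
       (∀ j, (∑ i, ((p.2 i : ℝ) : EReal) * h j (p.1 i)) ≤ ((μ j : ℝ) : EReal)) ∧
       frObj gi p ≠ ⊥}

/-- Optimal value of the finite reduction problem (FR). -/
def frVal {dz I J L : ℕ} (gi : Fin I → (Fin dz → ℝ) → EReal)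
    (c : Fin L → (Fin dz → ℝ) → EReal) (h : Fin J → (Fin dz → ℝ) → EReal)
    (μ : Fin J → ℝ) : EReal :=
  ⨆ p ∈ frFeas gi c h μ, frObj gi p

/-- (FR) is solvable. -/
def frSolvable {dz I J L : ℕ} (gi : Fin I → (Fin dz → ℝ) → EReal)
    (c : Fin L → (Fin dz → ℝ) → EReal) (h : Fin J → (Fin dz → ℝ) → EReal)
    (μ : Fin J → ℝ) : Prop :=
  frFeas gi c h μ = ∅ ∨ ∃ p ∈ frFeas gi c h μ, frObj gi p = frVal gi c h μ

/-- Feasible region of the ambiguous dual best problem (AD-B). -/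
def adbFeas {dz I J L : ℕ} (gi : Fin I → (Fin dz → ℝ) → EReal)
    (c : Fin L → (Fin dz → ℝ) → EReal) (h : Fin J → (Fin dz → ℝ) → EReal)
    (μ : Fin J → ℝ) :
    Set ((Fin I → (Fin dz → ℝ) × (Fin J → ℝ) × ℝ) × (Fin I → ℝ)) :=
  {p | (∀ i, p.1 i ∈ Uset gi c h i) ∧ (∀ i, 0 ≤ p.2 i) ∧ (∑ i, p.2 i) = 1 ∧
       (∀ j, (∑ i, p.2 i * (p.1 i).2.1 j) ≤ μ j)}

/-- Optimal value of the ambiguous dual best problem (AD-B). -/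
def adbVal {dz I J L : ℕ} (gi : Fin I → (Fin dz → ℝ) → EReal)
    (c : Fin L → (Fin dz → ℝ) → EReal) (h : Fin J → (Fin dz → ℝ) → EReal)
    (μ : Fin J → ℝ) : EReal :=
  ⨆ p ∈ adbFeas gi c h μ, (((∑ i, p.2 i * (p.1 i).2.2 : ℝ)) : EReal)

/-- (AD-B) is solvable. -/
def adbSolvable {dz I J L : ℕ} (gi : Fin I → (Fin dz → ℝ) → EReal)
    (c : Fin L → (Fin dz → ℝ) → EReal) (h : Fin J → (Fin dz → ℝ) → EReal)
    (μ : Fin J → ℝ) : Prop :=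
  adbFeas gi c h μ = ∅ ∨
    ∃ p ∈ adbFeas gi c h μ,
      (((∑ i, p.2 i * (p.1 i).2.2 : ℝ)) : EReal) = adbVal gi c h μ

/-- Affine ("linear") extended-real-valued function on a general normed space. -/
def IsAffineCLM {E : Type*} [NormedAddCommGroup E] [NormedSpace ℝ E]
    (g : E → EReal) : Prop :=
  ∃ (a : E →L[ℝ] ℝ) (b : ℝ), ∀ p, g p = ((a p + b : ℝ) : EReal)

/-- `i`-th constraint function of the reformulated ambiguous primal worst problem
(AP-W'): `(−g_i)*(y_i⁽⁰⁾) + Σ_j β_j h_j*(y_{ij}⁽¹⁾/β_j) + Σ_ℓ ν_{iℓ} c_ℓ*(y_{iℓ}⁽²⁾/ν_{iℓ}) − α`. -/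
def apwpCon {dz I J L : ℕ} (gi : Fin I → (Fin dz → ℝ) → EReal)
    (c : Fin L → (Fin dz → ℝ) → EReal) (h : Fin J → (Fin dz → ℝ) → EReal) (i : Fin I)
    (q : ℝ × (Fin J → ℝ) × (Fin I → Fin dz → ℝ) × (Fin I → Fin J → Fin dz → ℝ) ×
         (Fin I → Fin L → Fin dz → ℝ) × (Fin I → Fin L → ℝ)) : EReal :=
  conjFn (fun z => - gi i z) (q.2.2.1 i)
    + ∑ j, persp (conjFn (h j)) (q.2.2.2.1 i j) (q.2.1 j)
    + ∑ ℓ, persp (conjFn (c ℓ)) (q.2.2.2.2.1 i ℓ) (q.2.2.2.2.2 i ℓ)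
    - ((q.1 : ℝ) : EReal)

/-- Feasible region of (AP-W'). -/
def apwpFeas {dz I J L : ℕ} (gi : Fin I → (Fin dz → ℝ) → EReal)
    (c : Fin L → (Fin dz → ℝ) → EReal) (h : Fin J → (Fin dz → ℝ) → EReal) :
    Set (ℝ × (Fin J → ℝ) × (Fin I → Fin dz → ℝ) × (Fin I → Fin J → Fin dz → ℝ) ×
         (Fin I → Fin L → Fin dz → ℝ) × (Fin I → Fin L → ℝ)) :=
  {q | (∀ i, apwpCon gi c h i q ≤ 0) ∧
       (∀ i, (q.2.2.1 i + ∑ j, q.2.2.2.1 i j + ∑ ℓ, q.2.2.2.2.1 i ℓ) = 0) ∧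
       (∀ j, 0 ≤ q.2.1 j) ∧ (∀ i ℓ, 0 ≤ q.2.2.2.2.2 i ℓ)}

/-- Optimal value of (AP-W'). -/
def apwpVal {dz I J L : ℕ} (gi : Fin I → (Fin dz → ℝ) → EReal)
    (c : Fin L → (Fin dz → ℝ) → EReal) (h : Fin J → (Fin dz → ℝ) → EReal)
    (μ : Fin J → ℝ) : EReal :=
  ⨅ q ∈ apwpFeas gi c h, ((q.1 + dotp μ q.2.1 : ℝ) : EReal)

/-- (AP-W') is solvable. -/
def apwpSolvable {dz I J L : ℕ} (gi : Fin I → (Fin dz → ℝ) → EReal)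
    (c : Fin L → (Fin dz → ℝ) → EReal) (h : Fin J → (Fin dz → ℝ) → EReal)
    (μ : Fin J → ℝ) : Prop :=
  apwpFeas gi c h = ∅ ∨
    ∃ q ∈ apwpFeas gi c h, ((q.1 + dotp μ q.2.1 : ℝ) : EReal) = apwpVal gi c h μ

/-- Slater point of (AP-W') (whose further explicit constraints are affine equalities
and the linear inequalities `β ≥ 0`, `ν ≥ 0`). -/
def SlaterAPWP {dz I J L : ℕ} (gi : Fin I → (Fin dz → ℝ) → EReal)
    (c : Fin L → (Fin dz → ℝ) → EReal) (h : Fin J → (Fin dz → ℝ) → EReal)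
    (q : ℝ × (Fin J → ℝ) × (Fin I → Fin dz → ℝ) × (Fin I → Fin J → Fin dz → ℝ) ×
         (Fin I → Fin L → Fin dz → ℝ) × (Fin I → Fin L → ℝ)) : Prop :=
  (∀ i, q ∈ intrinsicInterior ℝ {r | apwpCon gi c h i r < ⊤}) ∧
  q ∈ apwpFeas gi c h ∧
  (∀ i, ¬ IsAffineCLM (apwpCon gi c h i) → apwpCon gi c h i q < 0)

/-- Strict Slater point of (AP-W'): all inequality constraints hold strictly. -/
def StrictSlaterAPWP {dz I J L : ℕ} (gi : Fin I → (Fin dz → ℝ) → EReal)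
    (c : Fin L → (Fin dz → ℝ) → EReal) (h : Fin J → (Fin dz → ℝ) → EReal)
    (q : ℝ × (Fin J → ℝ) × (Fin I → Fin dz → ℝ) × (Fin I → Fin J → Fin dz → ℝ) ×
         (Fin I → Fin L → Fin dz → ℝ) × (Fin I → Fin L → ℝ)) : Prop :=
  (∀ i, q ∈ intrinsicInterior ℝ {r | apwpCon gi c h i r < ⊤}) ∧
  (∀ i, (q.2.2.1 i + ∑ j, q.2.2.2.1 i j + ∑ ℓ, q.2.2.2.2.1 i ℓ) = 0) ∧
  (∀ i, apwpCon gi c h i q < 0) ∧ (∀ j, 0 < q.2.1 j) ∧ (∀ i ℓ, 0 < q.2.2.2.2.2 i ℓ)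

/-- Constraint function `λ_i c_ℓ(υ_i/λ_i)` of the reformulated ambiguous dual best
problem (AD-B'). -/
def adbpConC {dz I J L : ℕ} (c : Fin L → (Fin dz → ℝ) → EReal) (i : Fin I) (ℓ : Fin L)
    (r : (Fin I → ℝ) × (Fin I → ℝ) × (Fin I → Fin J → ℝ) × (Fin I → Fin dz → ℝ)) :
    EReal :=
  persp (c ℓ) (r.2.2.2 i) (r.2.1 i)

/-- Constraint function `λ_i h_j(υ_i/λ_i) − ω_{ij}` of (AD-B'). -/
def adbpConH {dz I J L : ℕ} (h : Fin J → (Fin dz → ℝ) → EReal) (i : Fin I) (j : Fin J)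
    (r : (Fin I → ℝ) × (Fin I → ℝ) × (Fin I → Fin J → ℝ) × (Fin I → Fin dz → ℝ)) :
    EReal :=
  persp (h j) (r.2.2.2 i) (r.2.1 i) - ((r.2.2.1 i j : ℝ) : EReal)

/-- Constraint function `τ_i − λ_i g_i(υ_i/λ_i)` of (AD-B') (concave perspective). -/
def adbpConG {dz I J L : ℕ} (gi : Fin I → (Fin dz → ℝ) → EReal) (i : Fin I)
    (r : (Fin I → ℝ) × (Fin I → ℝ) × (Fin I → Fin J → ℝ) × (Fin I → Fin dz → ℝ)) :
    EReal :=
  ((r.1 i : ℝ) : EReal) - cpersp (gi i) (r.2.2.2 i) (r.2.1 i)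

/-- Feasible region of (AD-B'). -/
def adbpFeas {dz I J L : ℕ} (gi : Fin I → (Fin dz → ℝ) → EReal)
    (c : Fin L → (Fin dz → ℝ) → EReal) (h : Fin J → (Fin dz → ℝ) → EReal)
    (μ : Fin J → ℝ) :
    Set ((Fin I → ℝ) × (Fin I → ℝ) × (Fin I → Fin J → ℝ) × (Fin I → Fin dz → ℝ)) :=
  {r | (∑ i, r.2.1 i) = 1 ∧ (∀ j, (∑ i, r.2.2.1 i j) ≤ μ j) ∧ (∀ i, 0 ≤ r.2.1 i) ∧
       (∀ i ℓ, adbpConC (J := J) c i ℓ r ≤ 0) ∧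
       (∀ i j, adbpConH (L := L) h i j r ≤ 0) ∧
       (∀ i, adbpConG (J := J) (L := L) gi i r ≤ 0)}

/-- Optimal value of (AD-B'). -/
def adbpVal {dz I J L : ℕ} (gi : Fin I → (Fin dz → ℝ) → EReal)
    (c : Fin L → (Fin dz → ℝ) → EReal) (h : Fin J → (Fin dz → ℝ) → EReal)
    (μ : Fin J → ℝ) : EReal :=
  ⨆ r ∈ adbpFeas gi c h μ, (((∑ i, r.1 i : ℝ)) : EReal)

/-- (AD-B') is solvable. -/
def adbpSolvable {dz I J L : ℕ} (gi : Fin I → (Fin dz → ℝ) → EReal)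
    (c : Fin L → (Fin dz → ℝ) → EReal) (h : Fin J → (Fin dz → ℝ) → EReal)
    (μ : Fin J → ℝ) : Prop :=
  adbpFeas gi c h μ = ∅ ∨
    ∃ r ∈ adbpFeas gi c h μ, (((∑ i, r.1 i : ℝ)) : EReal) = adbpVal gi c h μ

/-- Slater point of (AD-B') (whose further explicit constraints are the affine equality
`Σ_i λ_i = 1` and the linear inequalities `Σ_i ω_{ij} ≤ μ_j`, `λ ≥ 0`). -/
def SlaterADBP {dz I J L : ℕ} (gi : Fin I → (Fin dz → ℝ) → EReal)
    (c : Fin L → (Fin dz → ℝ) → EReal) (h : Fin J → (Fin dz → ℝ) → EReal)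
    (μ : Fin J → ℝ)
    (r : (Fin I → ℝ) × (Fin I → ℝ) × (Fin I → Fin J → ℝ) × (Fin I → Fin dz → ℝ)) :
    Prop :=
  (∀ i ℓ, r ∈ intrinsicInterior ℝ {s | adbpConC (J := J) c i ℓ s < ⊤}) ∧
  (∀ i j, r ∈ intrinsicInterior ℝ {s | adbpConH (L := L) h i j s < ⊤}) ∧
  (∀ i, r ∈ intrinsicInterior ℝ {s | adbpConG (J := J) (L := L) gi i s < ⊤}) ∧
  r ∈ adbpFeas gi c h μ ∧
  (∀ i ℓ, ¬ IsAffineCLM (adbpConC (dz := dz) (J := J) c i ℓ) →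
    adbpConC (J := J) c i ℓ r < 0) ∧
  (∀ i j, ¬ IsAffineCLM (adbpConH (dz := dz) (L := L) h i j) →
    adbpConH (L := L) h i j r < 0) ∧
  (∀ i, ¬ IsAffineCLM (adbpConG (dz := dz) (J := J) (L := L) gi i) →
    adbpConG (J := J) (L := L) gi i r < 0)

section FiniteDimensionalDuality

open Filter Topology

/-- Homogeneous Farkas lemma. -/
theorem farkas_finset {W κ : Type*} [AddCommGroup W] [Module ℝ W] (s : Finset κ) :
    ∀ (a : κ → W →ₗ[ℝ] ℝ) (φ : W →ₗ[ℝ] ℝ), (∀ x, (∀ k ∈ s, a k x ≤ 0) → φ x ≤ 0) →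
      ∃ l : κ → ℝ, (∀ k, 0 ≤ l k) ∧ φ = ∑ k ∈ s, l k • a k := by
  induction s using Finset.induction_on with
  | empty =>
    intro a φ hφ
    refine ⟨0, fun _ => le_rfl, ?_⟩
    ext x
    have h1 := hφ x (by simp)
    have h2 := hφ (-x) (by simp)
    simp only [map_neg] at h2
    simp only [Finset.sum_empty, LinearMap.zero_apply]
    linarith
  | insert k₀ s hk₀ ih =>
    intro a φ hφ
    by_cases hs : ∀ x, (∀ k ∈ s, a k x ≤ 0) → φ x ≤ 0
    · obtain ⟨l, hl, hsum⟩ := ih a φ hs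
      refine ⟨fun k => if k = k₀ then 0 else l k, fun k => ?_, ?_⟩
      · dsimp only
        split_ifs
        exacts [le_rfl, hl k]
      · rw [Finset.sum_insert hk₀]
        beta_reduce
        rw [if_pos rfl, zero_smul, zero_add, hsum]
        refine Finset.sum_congr rfl fun k hk => ?_
        rw [if_neg (ne_of_mem_of_not_mem hk hk₀)]
    · push Not at hs
      obtain ⟨y, hy, hφy⟩ := hs
      have hay : 0 < a k₀ y := by
        by_contra hcon
        refine absurd (hφ y fun k hk => ?_) (not_le.2 hφy)
        rcases Finset.mem_insert.1 hk with rfl | hk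
        exacts [not_lt.1 hcon, hy k hk]
      set c := (a k₀ y)⁻¹ with hc
      have hc0 : 0 < c := inv_pos.2 hay
      have hca : c * a k₀ y = 1 := inv_mul_cancel₀ hay.ne'
      obtain ⟨l, hl, hsum⟩ := ih (fun k => a k - (c * a k y) • a k₀) (φ - (c * φ y) • a k₀) (by
        intro x hx
        have key := hφ (x - (c * a k₀ x) • y) (by
          intro k hk
          rcases Finset.mem_insert.1 hk with rfl | hk
          · simp only [map_sub, map_smul, smul_eq_mul]
            have : c * a k x * a k y = a k x * (c * a k y) := by ring
            rw [this, hca]; simp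
          · have := hx k hk
            simp only [LinearMap.sub_apply, LinearMap.smul_apply, smul_eq_mul] at this
            simp only [map_sub, map_smul, smul_eq_mul]
            linarith)
        simp only [map_sub, map_smul, smul_eq_mul] at key
        simp only [LinearMap.sub_apply, LinearMap.smul_apply, smul_eq_mul]
        linarith)
      have hneg : ∑ k ∈ s, l k * a k y ≤ 0 :=
        Finset.sum_nonpos fun k hk => mul_nonpos_of_nonneg_of_nonpos (hl k) (hy k hk)
      refine ⟨fun k => if k = k₀ then c * (φ y - ∑ k ∈ s, l k * a k y) else l k,
        fun k => ?_, ?_⟩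
      · dsimp only
        split_ifs
        · exact mul_nonneg hc0.le (by linarith)
        · exact hl k
      · rw [Finset.sum_insert hk₀]
        beta_reduce
        rw [if_pos rfl]
        have : ∑ k ∈ s, (if k = k₀ then c * (φ y - ∑ k ∈ s, l k * a k y) else l k) • a k
            = ∑ k ∈ s, l k • a k :=
          Finset.sum_congr rfl fun k hk => by
            rw [if_neg (ne_of_mem_of_not_mem hk hk₀)]
        rw [this]
        ext x
        have hx := congrArg (fun f : W →ₗ[ℝ] ℝ => f x) hsum
        simp only [LinearMap.sub_apply, LinearMap.smul_apply, smul_eq_mul, LinearMap.sum_apply,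
          mul_sub, Finset.sum_sub_distrib] at hx
        have h2 : ∑ k ∈ s, l k * (c * a k y * a k₀ x)
            = (∑ k ∈ s, l k * a k y) * (c * a k₀ x) := by
          rw [Finset.sum_mul]
          exact Finset.sum_congr rfl fun k _ => by ring
        simp only [LinearMap.add_apply, LinearMap.smul_apply, smul_eq_mul, LinearMap.sum_apply]
        rw [h2] at hx
        linear_combination hx

/-- Inhomogeneous Farkas lemma over a nonempty polyhedron. -/
theorem farkas_affine {W κ : Type*} [Fintype κ] [AddCommGroup W] [Module ℝ W]
    (a : κ → W →ₗ[ℝ] ℝ) (b : κ → ℝ) (p : W) (hp : ∀ k, a k p ≤ b k) (ψ : W →ₗ[ℝ] ℝ) (s : ℝ)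
    (hψ : ∀ x, (∀ k, a k x ≤ b k) → ψ x ≤ s) :
    ∃ l : κ → ℝ, (∀ k, 0 ≤ l k) ∧ (∀ x, ψ x = ∑ k, l k * a k x) ∧ ∑ k, l k * b k ≤ s := by
  let A : Option κ → (W × ℝ) →ₗ[ℝ] ℝ := fun o =>
    o.elim (-LinearMap.snd ℝ W ℝ) fun k =>
      (a k).comp (LinearMap.fst ℝ W ℝ) - b k • LinearMap.snd ℝ W ℝ
  obtain ⟨l, hl, hsum⟩ := farkas_finset Finset.univ A
    (ψ.comp (LinearMap.fst ℝ W ℝ) - s • LinearMap.snd ℝ W ℝ) (by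
      rintro ⟨x, t⟩ hx
      have ht : 0 ≤ t := by
        have := hx none (Finset.mem_univ _)
        simp only [A, Option.elim, LinearMap.neg_apply, LinearMap.snd_apply] at this
        linarith
      have hk : ∀ k, a k x ≤ b k * t := fun k => by
        have := hx (some k) (Finset.mem_univ _)
        simp only [A, Option.elim, LinearMap.sub_apply, LinearMap.comp_apply,
          LinearMap.fst_apply, LinearMap.smul_apply, LinearMap.snd_apply, smul_eq_mul] at this
        linarith
      simp only [LinearMap.sub_apply, LinearMap.comp_apply,
          LinearMap.fst_apply, LinearMap.smul_apply, LinearMap.snd_apply, smul_eq_mul]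
      rcases ht.eq_or_lt with rfl | ht
      · by_contra hcon
        have hpos : 0 < ψ x := by simpa using hcon
        obtain ⟨n, hn⟩ := exists_nat_gt ((s - ψ p) / ψ x)
        rw [div_lt_iff₀ hpos] at hn
        have := hψ (p + (n : ℝ) • x) fun k => by
          have h1 := hk k
          have h2 := hp k
          simp only [map_add, map_smul, smul_eq_mul]
          have : (n : ℝ) * a k x ≤ 0 :=
            mul_nonpos_of_nonneg_of_nonpos (Nat.cast_nonneg n) (by linarith)
          linarith
        simp only [map_add, map_smul, smul_eq_mul] at this
        linarith
      · have := hψ (t⁻¹ • x) fun k => by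
          simp only [map_smul, smul_eq_mul]
          rw [inv_mul_le_iff₀ ht]
          linarith [hk k]
        simp only [map_smul, smul_eq_mul] at this
        rw [inv_mul_le_iff₀ ht] at this
        linarith)
  rw [Fintype.sum_option] at hsum
  refine ⟨fun k => l (some k), fun k => hl _, fun x => ?_, ?_⟩
  · have := congrArg (fun f : (W × ℝ) →ₗ[ℝ] ℝ => f (x, 0)) hsum
    simpa [A, LinearMap.sum_apply] using this
  · have := congrArg (fun f : (W × ℝ) →ₗ[ℝ] ℝ => f (0, 1)) hsum
    simp [A, LinearMap.sum_apply] at this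
    linarith [hl none]

/-- `a` is a relative (algebraic) interior point of `A`. -/
def RelIntAt {E : Type*} [AddCommGroup E] [Module ℝ E] (A : Set E) (a : E) : Prop :=
  a ∈ A ∧ ∀ x ∈ A, ∀ᶠ ε in 𝓝[>] (0 : ℝ), a + ε • (a - x) ∈ A

/-- Lagrange multipliers for a convex set with nonempty interior containing the feasible origin. -/
theorem exists_multipliers_of_mem_interior {X κ : Type*} [NormedAddCommGroup X] [NormedSpace ℝ X]
    [Fintype κ] {C : Set X} (hC : Convex ℝ C) (h0 : (0 : X) ∈ interior C)
    (a : κ → X →ₗ[ℝ] ℝ) (b : κ → ℝ) (hb : ∀ k, 0 ≤ b k) (φ : X →L[ℝ] ℝ) (M : ℝ)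
    (hφ : ∀ x ∈ C, (∀ k, a k x ≤ b k) → φ x ≤ M) :
    ∃ l : κ → ℝ, (∀ k, 0 ≤ l k) ∧ ∀ x ∈ C, φ x - M ≤ ∑ k, l k * (a k x - b k) := by
  have hφ0 : 0 ≤ M := by simpa using hφ 0 (interior_subset h0) (by simpa using hb)
  -- it suffices to have the inequality on the interior
  suffices H : ∃ l : κ → ℝ, (∀ k, 0 ≤ l k) ∧
      ∀ x ∈ interior C, φ x - M ≤ ∑ k, l k * (a k x - b k) by
    obtain ⟨l, hl, hx⟩ := H
    refine ⟨l, hl, fun x hxC => ?_⟩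
    have hseg : ∀ t : ℝ, 0 < t → t < 1 →
        (1 - t) * φ x - M ≤ (1 - t) * (∑ k, l k * a k x) - ∑ k, l k * b k := by
      intro t ht ht1
      have hmem := hC.combo_interior_self_mem_interior h0 hxC ht (by linarith : 0 ≤ 1 - t)
        (by ring)
      have := hx _ hmem
      simp only [smul_zero, zero_add, map_smul, smul_eq_mul, mul_sub, Finset.sum_sub_distrib] at this
      rw [Finset.mul_sum]
      calc (1 - t) * φ x - M ≤ _ := this
        _ = _ := by
          congr 1
          exact Finset.sum_congr rfl fun k _ => by ring
    have e : ∑ k, l k * (a k x - b k) = ∑ k, l k * a k x - ∑ k, l k * b k := by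
      simp only [mul_sub, Finset.sum_sub_distrib]
    rw [e]
    have hlim : Tendsto (fun t : ℝ => (1 - t) * (∑ k, l k * a k x) - ∑ k, l k * b k
        - ((1 - t) * φ x - M)) (𝓝[>] 0)
        (𝓝 ((1 - 0) * (∑ k, l k * a k x) - ∑ k, l k * b k - ((1 - 0) * φ x - M))) := by
      apply Tendsto.mono_left _ nhdsWithin_le_nhds
      apply Continuous.tendsto
      fun_prop
    have := ge_of_tendsto hlim (by
      filter_upwards [Ioo_mem_nhdsGT (zero_lt_one : (0 : ℝ) < 1)] with t ht
      exact sub_nonneg.2 (hseg t ht.1 ht.2))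
    linarith
  set O : Set X := interior C ∩ {x | M < φ x} with hO
  by_cases hOne : O.Nonempty
  swap
  · refine ⟨0, fun _ => le_rfl, fun x hx => ?_⟩
    by_contra hcon
    refine hOne ⟨x, hx, ?_⟩
    simp at hcon
    exact hcon
  set P : Set X := {x | ∀ k, a k x ≤ b k} with hP
  have hPconv : Convex ℝ P := by
    have : P = ⋂ k, {x | a k x ≤ b k} := by ext; simp [hP]
    rw [this]
    exact convex_iInter fun k => convex_halfSpace_le (a k).isLinear (b k)
  have hOconv : Convex ℝ O :=
    hC.interior.inter (convex_halfSpace_gt φ.toLinearMap.isLinear M)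
  have hOopen : IsOpen O :=
    isOpen_interior.inter (isOpen_lt continuous_const φ.continuous)
  have hdisj : Disjoint O P := by
    rw [Set.disjoint_left]
    rintro x ⟨hxC, hxM⟩ hxP
    exact absurd (hφ x (interior_subset hxC) hxP) (not_le.2 hxM)
  obtain ⟨f, u, hfO, hfP⟩ := geometric_hahn_banach_open hOconv hOopen hPconv hdisj
  obtain ⟨l, hl, hlf, hlb⟩ := farkas_affine a b 0 (by simpa using hb) (-f.toLinearMap) (-u)
    (by intro x hx; simpa using hfP x hx)
  set A : X → ℝ := fun x => -(f x) - ∑ k, l k * b k with hA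
  have hAsum : ∀ x, A x = ∑ k, l k * (a k x - b k) := by
    intro x
    have := hlf x
    simp only [LinearMap.neg_apply, ContinuousLinearMap.coe_coe] at this
    simp only [hA, mul_sub, Finset.sum_sub_distrib, this]
  have hApos : ∀ x ∈ interior C, M < φ x → 0 < A x := by
    intro x hx hM
    have := hfO x ⟨hx, hM⟩
    simp only [hA]
    linarith
  have hBnn : 0 ≤ ∑ k, l k * b k := Finset.sum_nonneg fun k _ => mul_nonneg (hl k) (hb k)
  have hCint := hC.interior
  -- a strict Slater point for the aggregated constraint
  obtain ⟨y₀, hy₀, hAy₀⟩ : ∃ y ∈ interior C, A y < 0 := by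
    obtain ⟨x, hxC, hxM⟩ := hOne
    have hAx := hApos x hxC hxM
    have hev : ∀ᶠ t in 𝓝[>] (0 : ℝ), (-t) • x ∈ interior C := by
      have : Tendsto (fun t : ℝ => (-t) • x) (𝓝 0) (𝓝 ((-(0 : ℝ)) • x)) := by
        apply Continuous.tendsto
        fun_prop
      simp only [neg_zero, zero_smul] at this
      exact (this.eventually (isOpen_interior.mem_nhds h0)).filter_mono nhdsWithin_le_nhds
    obtain ⟨t, ht, ht0⟩ := (hev.and self_mem_nhdsWithin).exists
    refine ⟨_, ht, ?_⟩
    have ht0 : 0 < t := ht0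
    simp only [hA, map_smul, smul_eq_mul] at hAx ⊢
    nlinarith
  have hratio : ∀ x ∈ interior C, 0 < A x → ∀ y ∈ interior C, A y < 0 →
      (φ x - M) / A x ≤ (M - φ y) / (-A y) := by
    intro x hx hAx y hy hAy
    rw [div_le_div_iff₀ hAx (by linarith)]
    by_contra hcon
    push Not at hcon
    have hden : 0 < A x - A y := by linarith
    have hz := hCint hx hy (a := (-A y) / (A x - A y)) (b := A x / (A x - A y))
      (div_nonneg (by linarith) hden.le) (div_nonneg hAx.le hden.le) (by field_simp; ring)
    have h1 := hApos _ hz (by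
      simp only [map_add, map_smul, smul_eq_mul]
      rw [← mul_lt_mul_iff_of_pos_right hden]
      have : (-A y / (A x - A y) * φ x + A x / (A x - A y) * φ y) * (A x - A y)
        = -A y * φ x + A x * φ y := by field_simp
      rw [this]
      linarith)
    have h2 : A (((-A y) / (A x - A y)) • x + (A x / (A x - A y)) • y) = 0 := by
      have hfx : f x = -A x - ∑ k, l k * b k := by simp only [hA]; ring
      have hfy : f y = -A y - ∑ k, l k * b k := by simp only [hA]; ring
      rw [show ∀ z, A z = -(f z) - ∑ k, l k * b k from fun _ => rfl]
      simp only [map_add, map_smul, smul_eq_mul, hfx, hfy]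
      field_simp
      ring
    linarith
  set R : Set ℝ := {r | ∃ x ∈ interior C, 0 < A x ∧ r = (φ x - M) / A x} with hR
  have hRbdd : BddAbove R := ⟨(M - φ y₀) / (-A y₀), by
    rintro _ ⟨x, hx, hAx, rfl⟩
    exact hratio x hx hAx y₀ hy₀ hAy₀⟩
  have hRne : R.Nonempty := by
    obtain ⟨x, hxC, hxM⟩ := hOne
    exact ⟨_, x, hxC, hApos x hxC hxM, rfl⟩
  set κ₀ := sSup R with hκ
  have hκ0 : 0 ≤ κ₀ := by
    obtain ⟨x, hxC, hxM⟩ := hOne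
    have hAx := hApos x hxC hxM
    have hxM : M < φ x := hxM
    refine le_trans ?_ (le_csSup hRbdd ⟨x, hxC, hAx, rfl⟩)
    exact div_nonneg (by linarith) hAx.le
  refine ⟨fun k => κ₀ * l k, fun k => mul_nonneg hκ0 (hl k), fun x hx => ?_⟩
  have : ∑ k, κ₀ * l k * (a k x - b k) = κ₀ * A x := by
    rw [hAsum, Finset.mul_sum]
    exact Finset.sum_congr rfl fun k _ => by ring
  rw [this]
  rcases lt_trichotomy (A x) 0 with hAx | hAx | hAx
  · have : κ₀ ≤ (M - φ x) / (-A x) := csSup_le hRne (by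
      rintro _ ⟨z, hz, hAz, rfl⟩
      exact hratio z hz hAz x hx hAx)
    rw [le_div_iff₀ (by linarith)] at this
    linarith
  · rw [hAx, mul_zero]
    by_contra hcon
    have := hApos x hx (by linarith)
    linarith
  · have : (φ x - M) / A x ≤ κ₀ := le_csSup hRbdd ⟨x, hx, hAx, rfl⟩
    rwa [div_le_iff₀ hAx] at this

/-- Lagrange multipliers for finitely many linear inequalities that hold at a relative interior
point of a convex set. -/
theorem exists_multipliers_of_relIntAt {X κ : Type*} [NormedAddCommGroup X] [NormedSpace ℝ X]
    [FiniteDimensional ℝ X] [Fintype κ] {C : Set X} (hC : Convex ℝ C) {x₀ : X}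
    (hx₀ : RelIntAt C x₀) (a : κ → X →ₗ[ℝ] ℝ) (b : κ → ℝ) (hb : ∀ k, a k x₀ ≤ b k)
    (φ : X →ₗ[ℝ] ℝ) (M : ℝ) (hφ : ∀ x ∈ C, (∀ k, a k x ≤ b k) → φ x ≤ M) :
    ∃ l : κ → ℝ, (∀ k, 0 ≤ l k) ∧ ∀ x ∈ C, φ x - M ≤ ∑ k, l k * (a k x - b k) := by
  set S : Submodule ℝ X := Submodule.span ℝ ((fun x => x - x₀) '' C) with hS
  set D : Set S := {y | x₀ + (y : X) ∈ C} with hD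
  have hDconv : Convex ℝ D := by
    intro y hy z hz s t hs ht hst
    have := hC hy hz hs ht hst
    simp only [hD, Set.mem_ofPred_eq, Submodule.coe_add, Submodule.coe_smul]
    convert this using 1
    have : x₀ = s • x₀ + t • x₀ := by rw [← add_smul, hst, one_smul]
    nth_rewrite 1 [this]
    simp only [smul_add]
    abel
  have h0D : (0 : S) ∈ D := by simpa [hD] using hx₀.1
  have hspan : Submodule.span ℝ D = ⊤ := by
    have : D = (↑) ⁻¹' ((fun x => x - x₀) '' C) := by
      ext y
      simp only [hD, Set.mem_ofPred_eq, Set.mem_preimage, Set.mem_image]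
      constructor
      · intro hy
        exact ⟨_, hy, by simp⟩
      · rintro ⟨x, hx, hxy⟩
        rw [← hxy]
        simpa using hx
    rw [this, hS]
    exact Submodule.span_span_coe_preimage
  have hint : (interior D).Nonempty := by
    rw [hDconv.interior_nonempty_iff_affineSpan_eq_top]
    rw [AffineSubspace.affineSpan_eq_top_iff_vectorSpan_eq_top_of_nonempty ℝ S S ⟨0, h0D⟩,
      vectorSpan_eq_span_vsub_set_right ℝ h0D]
    simpa using hspan
  have h0int : (0 : S) ∈ interior D := by
    obtain ⟨y, hy⟩ := hint
    have hyC : x₀ + (y : X) ∈ C := interior_subset (s := D) hy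
    obtain ⟨ε, hε, hε0⟩ := ((hx₀.2 _ hyC).and self_mem_nhdsWithin).exists
    have hε0 : 0 < ε := hε0
    have hmem : (-ε) • y ∈ D := by
      simp only [hD, Set.mem_ofPred_eq, Submodule.coe_smul]
      convert hε using 2
      simp
    have := hDconv.combo_interior_self_mem_interior hy hmem (a := ε / (1 + ε)) (b := 1 / (1 + ε))
      (by positivity) (by positivity) (by field_simp; ring)
    convert this using 1
    rw [smul_smul, ← add_smul]
    have : ε / (1 + ε) + 1 / (1 + ε) * -ε = 0 := by field_simp; ring
    rw [this, zero_smul]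
  obtain ⟨l, hl, hlx⟩ := exists_multipliers_of_mem_interior hDconv h0int
    (fun k => (a k).comp S.subtype) (fun k => b k - a k x₀) (fun k => sub_nonneg.2 (hb k))
    (LinearMap.toContinuousLinearMap (φ.comp S.subtype)) (M - φ x₀) (by
      intro y hy hk
      have := hφ _ hy (fun k => by
        have := hk k
        simp only [LinearMap.comp_apply, Submodule.subtype_apply] at this
        rw [map_add]
        linarith)
      rw [map_add] at this
      simp only [LinearMap.coe_toContinuousLinearMap', LinearMap.comp_apply, Submodule.subtype_apply]
      linarith)
  refine ⟨l, hl, fun x hx => ?_⟩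
  have hxS : x - x₀ ∈ S := Submodule.subset_span ⟨x, hx, rfl⟩
  have := hlx ⟨x - x₀, hxS⟩ (by simpa [hD] using hx)
  simp only [LinearMap.coe_toContinuousLinearMap', LinearMap.comp_apply, Submodule.subtype_apply,
    map_sub] at this
  calc φ x - M = φ x - φ x₀ - (M - φ x₀) := by ring
    _ ≤ _ := this
    _ = _ := Finset.sum_congr rfl fun k _ => by ring

/-- Lagrange multipliers for linear inequalities and equalities that hold at a relative interior
point of a convex set. -/
theorem exists_multipliers_ineq_eq {X κ η : Type*} [NormedAddCommGroup X] [NormedSpace ℝ X]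
    [FiniteDimensional ℝ X] [Fintype κ] [Fintype η] {C : Set X} (hC : Convex ℝ C) {x₀ : X}
    (hx₀ : RelIntAt C x₀) (a : κ → X →ₗ[ℝ] ℝ) (b : κ → ℝ) (hb : ∀ k, a k x₀ ≤ b k)
    (e : η → X →ₗ[ℝ] ℝ) (d : η → ℝ) (hd : ∀ k, e k x₀ = d k)
    (φ : X →ₗ[ℝ] ℝ) (M : ℝ)
    (hφ : ∀ x ∈ C, (∀ k, a k x ≤ b k) → (∀ k, e k x = d k) → φ x ≤ M) :
    ∃ (l : κ → ℝ) (m : η → ℝ), (∀ k, 0 ≤ l k) ∧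
      ∀ x ∈ C, φ x - M ≤ ∑ k, l k * (a k x - b k) + ∑ k, m k * (e k x - d k) := by
  obtain ⟨l, hl, hx⟩ := exists_multipliers_of_relIntAt hC hx₀
    (Sum.elim a (Sum.elim e (fun k => - e k))) (Sum.elim b (Sum.elim d (fun k => - d k)))
    (by rintro (k | k | k) <;> simp [hb, hd]) φ M (by
      intro x hx hk
      refine hφ x hx (fun k => hk (.inl k)) fun k => le_antisymm (hk (.inr (.inl k))) ?_
      have := hk (.inr (.inr k))
      simpa using this)
  refine ⟨fun k => l (.inl k), fun k => l (.inr (.inl k)) - l (.inr (.inr k)),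
    fun k => hl _, fun x hxC => (hx x hxC).trans_eq ?_⟩
  simp only [Fintype.sum_sum_type, Sum.elim_inl, Sum.elim_inr, LinearMap.neg_apply]
  congr 1
  rw [← Finset.sum_add_distrib]
  exact Finset.sum_congr rfl fun k _ => by ring

end FiniteDimensionalDuality

section ConicDuality

open Filter Topology

variable {ι κ E : Type*} [AddCommGroup E] [Module ℝ E]

/-- The product over `i` of the (blunt) cones generated by `{1} × ∏ k, A i k`. -/
def prodCone (A : ι → κ → Set E) : Set (ι → ℝ × (κ → E)) :=
  {x | ∀ i, 0 < (x i).1 ∧ ∀ k, (x i).1⁻¹ • (x i).2 k ∈ A i k}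

theorem smul_mem_prodCone {A : ι → κ → Set E} {p : ι → κ → E} (hp : ∀ i k, p i k ∈ A i k)
    {r : ι → ℝ} (hr : ∀ i, 0 < r i) : (fun i => (r i, r i • p i)) ∈ prodCone A := by
  intro i
  refine ⟨hr i, fun k => ?_⟩
  simpa [smul_smul, inv_mul_cancel₀ (hr i).ne'] using hp i k

theorem convex_prodCone {A : ι → κ → Set E} (hA : ∀ i k, Convex ℝ (A i k)) :
    Convex ℝ (prodCone A) := by
  intro x hx y hy s t hs ht hst i
  have hpos : 0 < s * (x i).1 + t * (y i).1 :=
    convex_Ioi (0 : ℝ) (hx i).1 (hy i).1 hs ht hst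
  refine ⟨hpos, fun k => ?_⟩
  have hxi := (hx i).1
  have hyi := (hy i).1
  have := hA i k ((hx i).2 k) ((hy i).2 k)
    (a := s * (x i).1 / (s * (x i).1 + t * (y i).1))
    (b := t * (y i).1 / (s * (x i).1 + t * (y i).1))
    (by positivity) (by positivity) (by field_simp)
  convert this using 1
  simp only [Pi.add_apply, Pi.smul_apply, Prod.fst_add, Prod.smul_fst, Prod.snd_add,
    Prod.smul_snd, smul_eq_mul, smul_add, smul_smul]
  congr 2 <;> field_simp

theorem relIntAt_prodCone [Finite ι] [Finite κ] {A : ι → κ → Set E} {a : ι → κ → E}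
    (ha : ∀ i k, RelIntAt (A i k) (a i k)) {l : ι → ℝ} (hl : ∀ i, 0 < l i) :
    RelIntAt (prodCone A) (fun i => (l i, l i • a i)) := by
  refine ⟨smul_mem_prodCone (fun i k => (ha i k).1) hl, fun x hx => ?_⟩
  have hden : ∀ i, ∀ᶠ ε in 𝓝[>] (0 : ℝ), 0 < l i + ε * (l i - (x i).1) := by
    intro i
    have : Tendsto (fun ε : ℝ => l i + ε * (l i - (x i).1)) (𝓝 0)
        (𝓝 (l i + 0 * (l i - (x i).1))) := by
      apply Continuous.tendsto
      fun_prop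
    rw [zero_mul, add_zero] at this
    exact (this.eventually (lt_mem_nhds (hl i))).filter_mono nhdsWithin_le_nhds
  have hmem : ∀ i k, ∀ᶠ ε in 𝓝[>] (0 : ℝ),
      a i k + (ε * (x i).1 / (l i + ε * (l i - (x i).1))) • (a i k - (x i).1⁻¹ • (x i).2 k)
        ∈ A i k := by
    intro i k
    have hlim : Tendsto (fun ε : ℝ => ε * (x i).1 / (l i + ε * (l i - (x i).1))) (𝓝[>] 0)
        (𝓝[>] 0) := by
      rw [tendsto_nhdsWithin_iff]
      constructor
      · have : ContinuousAt (fun ε : ℝ => ε * (x i).1 / (l i + ε * (l i - (x i).1))) 0 := by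
          apply ContinuousAt.div
          · fun_prop
          · fun_prop
          · simpa using (hl i).ne'
        have h2 := this.tendsto
        simp only [zero_mul, zero_div] at h2
        exact h2.mono_left nhdsWithin_le_nhds
      · filter_upwards [hden i, self_mem_nhdsWithin] with ε h1 h2
        exact div_pos (mul_pos h2 (hx i).1) h1
    exact hlim.eventually ((ha i k).2 _ ((hx i).2 k))
  filter_upwards [eventually_all.2 hden, eventually_all.2 fun i => eventually_all.2 (hmem i)]
    with ε h1 h2 i
  refine ⟨by simpa using h1 i, fun k => ?_⟩
  convert h2 i k using 1
  have hd := h1 i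
  have hxi := (hx i).1
  simp only [Pi.add_apply, Pi.smul_apply, Pi.sub_apply, Prod.fst_add, Prod.smul_fst, Prod.snd_add,
    Prod.smul_snd, Prod.fst_sub, Prod.snd_sub, smul_eq_mul, smul_add, smul_smul, smul_sub]
  have e1 : (l i + ε * (l i - (x i).1))⁻¹ * l i + (l i + ε * (l i - (x i).1))⁻¹ * (ε * l i)
      = 1 + ε * (x i).1 / (l i + ε * (l i - (x i).1)) := by
    field_simp
    ring
  have e2 : (l i + ε * (l i - (x i).1))⁻¹ * ε
      = ε * (x i).1 / (l i + ε * (l i - (x i).1)) * (x i).1⁻¹ := by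
    field_simp
  rw [← mul_sub, ← add_sub_assoc, ← add_smul, e1, e2, add_smul, one_smul]
  abel

/-- A linear form bounded above on the open positive orthant is nonpositive there, and the bound
is nonnegative. -/
theorem nonpos_of_forall_pos_sum_mul_le [Fintype ι] [Nonempty ι] {c : ι → ℝ} {R : ℝ}
    (h : ∀ r : ι → ℝ, (∀ i, 0 < r i) → ∑ i, r i * c i ≤ R) : 0 ≤ R ∧ ∀ i, c i ≤ 0 := by
  constructor
  · have hlim : Tendsto (fun t : ℝ => ∑ i, t * c i) (𝓝[>] 0) (𝓝 (∑ i, 0 * c i)) := by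
      apply Tendsto.mono_left _ nhdsWithin_le_nhds
      apply Continuous.tendsto (f := fun t : ℝ => ∑ i, t * c i)
      fun_prop
    simp only [zero_mul, Finset.sum_const_zero] at hlim
    refine le_of_tendsto hlim ?_
    filter_upwards [self_mem_nhdsWithin] with t ht
    exact h (fun _ => t) fun _ => ht
  · intro i
    by_contra hcon
    push Not at hcon
    set M := 1 + (|R - ∑ i, c i| + 1) / c i with hM
    have hMpos : 0 < M := by positivity
    have := h (fun k => 1 + if k = i then M - 1 else 0) (fun k => by
      split_ifs <;> linarith)
    simp only [add_mul, one_mul, Finset.sum_add_distrib, ite_mul, zero_mul,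
      Finset.sum_ite_eq', Finset.mem_univ, if_true] at this
    have e : (M - 1) * c i = |R - ∑ i, c i| + 1 := by
      rw [hM]
      field_simp
      ring
    rw [e] at this
    linarith [le_abs_self (R - ∑ i, c i)]

end ConicDuality

/-- The weights of the epigraph heights in the Lagrangian: `1` for the objective, `β` for the
moment functions and `ν` for the support constraints. -/
def lagWeight {J L : ℕ} (β : Fin J → ℝ) (ν : Fin L → ℝ) (k : Option (Fin J ⊕ Fin L)) : ℝ :=
  k.elim 1 (Sum.elim β ν)

/-- Lagrangian duality for a mixture of convex programs, in terms of convex sets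
`A i k ⊆ ℝⁿ × ℝ` (playing the role of epigraphs). -/
theorem exists_mixture_multipliers {n I J L : ℕ} [Nonempty (Fin I)]
    {A : Fin I → Option (Fin J ⊕ Fin L) → Set ((Fin n → ℝ) × ℝ)} (hA : ∀ i k, Convex ℝ (A i k))
    {z : Fin I → Fin n → ℝ} {s : Fin I → Option (Fin J ⊕ Fin L) → ℝ}
    (hs : ∀ i k, RelIntAt (A i k) (z i, s i k)) {l : Fin I → ℝ} (hl : ∀ i, 0 < l i)
    (hl1 : ∑ i, l i = 1) {μ : Fin J → ℝ}
    (hsμ : ∀ j, ∑ i, l i * s i (some (.inl j)) ≤ μ j) (hsc : ∀ i k, s i (some (.inr k)) ≤ 0)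
    {V : ℝ}
    (hV : ∀ (r : Fin I → ℝ) (w : Fin I → Fin n → ℝ) (u : Fin I → Option (Fin J ⊕ Fin L) → ℝ),
      (∀ i, 0 < r i) → ∑ i, r i = 1 → (∀ i k, (w i, u i k) ∈ A i k) →
      (∀ j, ∑ i, r i * u i (some (.inl j)) ≤ μ j) → (∀ i k, u i (some (.inr k)) ≤ 0) →
      ∑ i, r i * -(u i none) ≤ V) :
    ∃ (α : ℝ) (β : Fin J → ℝ) (ν : Fin I → Fin L → ℝ)
      (Y : Fin I → Option (Fin J ⊕ Fin L) → Fin n → ℝ),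
      (∀ j, 0 ≤ β j) ∧ (∀ i k, 0 ≤ ν i k) ∧ α + dotp μ β ≤ V ∧ (∀ i, ∑ k, Y i k = 0) ∧
      ∀ i, ∀ p : Option (Fin J ⊕ Fin L) → (Fin n → ℝ) × ℝ, (∀ k, p k ∈ A i k) →
        ∑ k, (dotp (Y i k) (p k).1 - lagWeight β (ν i) k * (p k).2) ≤ α := by
  let X := Fin I → ℝ × (Option (Fin J ⊕ Fin L) → (Fin n → ℝ) × ℝ)
  let wt : Fin I → X →ₗ[ℝ] ℝ := fun i =>
    { toFun := fun x => (x i).1, map_add' := fun _ _ => rfl, map_smul' := fun _ _ => rfl }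
  let ht : Fin I → Option (Fin J ⊕ Fin L) → X →ₗ[ℝ] ℝ := fun i k =>
    { toFun := fun x => ((x i).2 k).2, map_add' := fun _ _ => rfl, map_smul' := fun _ _ => rfl }
  let pt : Fin I → Option (Fin J ⊕ Fin L) → Fin n → X →ₗ[ℝ] ℝ := fun i k d =>
    { toFun := fun x => ((x i).2 k).1 d, map_add' := fun _ _ => rfl, map_smul' := fun _ _ => rfl }
  obtain ⟨a, m, ha, hx⟩ := exists_multipliers_ineq_eq (convex_prodCone hA)
    (relIntAt_prodCone hs hl)
    (Sum.elim (fun j => ∑ i, ht i (some (.inl j)))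
      (fun q : Fin I × Fin L => ht q.1 (some (.inr q.2))))
    (Sum.elim μ (fun _ => 0))
    (by
      rintro (j | ⟨i, k⟩)
      · simpa [ht, LinearMap.sum_apply] using hsμ j
      · simpa [ht] using mul_nonpos_of_nonneg_of_nonpos (hl i).le (hsc i k))
    (Sum.elim (fun _ : Unit => ∑ i, wt i)
      (fun q : Fin I × (Fin J ⊕ Fin L) × Fin n =>
        pt q.1 (some q.2.1) q.2.2 - pt q.1 none q.2.2))
    (Sum.elim (fun _ => 1) (fun _ => 0))
    (by
      rintro (_ | ⟨i, k, d⟩)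
      · simpa [wt, LinearMap.sum_apply] using hl1
      · simp [pt])
    (∑ i, -ht i none) V (by
      intro x hxC hineq heq
      have hr := fun i => (hxC i).1
      have h1 : ∑ i, (x i).1 = 1 := by
        simpa [wt, LinearMap.sum_apply] using heq (.inl ())
      have hpt : ∀ i k, ((x i).2 k).1 = ((x i).2 none).1 := by
        intro i k
        rcases k with _ | k
        · rfl
        · funext d
          have := heq (.inr (i, k, d))
          simpa [pt, sub_eq_zero] using this
      have hmul : ∀ i (y : ℝ), (x i).1 * ((x i).1⁻¹ * y) = y := fun i y => by
        rw [mul_inv_cancel_left₀ (hr i).ne']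
      have := hV (fun i => (x i).1) (fun i => (x i).1⁻¹ • ((x i).2 none).1)
        (fun i k => (x i).1⁻¹ * ((x i).2 k).2) hr h1
        (fun i k => by
          have := (hxC i).2 k
          rw [← hpt i k]
          exact this)
        (fun j => by
          have := hineq (.inl j)
          simp only [hmul]
          simpa [ht, LinearMap.sum_apply] using this)
        (fun i k => by
          have := hineq (.inr (i, k))
          refine mul_nonpos_of_nonneg_of_nonpos (inv_nonneg.2 (hr i).le) ?_
          simpa [ht] using this)
      simpa [mul_neg, hmul, ht, LinearMap.sum_apply] using this)
  set α := m (.inl ()) with hα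
  set β : Fin J → ℝ := fun j => a (.inl j) with hβ
  set ν : Fin I → Fin L → ℝ := fun i k => a (.inr (i, k)) with hν
  set Y : Fin I → Option (Fin J ⊕ Fin L) → Fin n → ℝ := fun i k d =>
    k.elim (∑ k', m (.inr (i, k', d))) (fun k' => -m (.inr (i, k', d))) with hY
  have key : ∀ p : Fin I → Option (Fin J ⊕ Fin L) → (Fin n → ℝ) × ℝ, (∀ i k, p i k ∈ A i k) →
      ∀ r : Fin I → ℝ, (∀ i, 0 < r i) →
      ∑ i, r i * (∑ k, (dotp (Y i k) (p i k).1 - lagWeight β (ν i) k * (p i k).2) - α)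
        ≤ V - α - dotp μ β := by
    intro p hp r hr
    have := hx _ (smul_mem_prodCone hp hr)
    have e1 : ∀ i, ∑ k, dotp (Y i k) (p i k).1
        = - ∑ k : Fin J ⊕ Fin L, ∑ d, m (.inr (i, k, d)) *
            ((p i (some k)).1 d - (p i none).1 d) := by
      intro i
      rw [Fintype.sum_option]
      simp only [dotp, hY, Option.elim]
      have : ∑ d, (∑ k', m (.inr (i, k', d))) * (p i none).1 d
          = ∑ k' : Fin J ⊕ Fin L, ∑ d, m (.inr (i, k', d)) * (p i none).1 d := by
        rw [Finset.sum_comm]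
        exact Finset.sum_congr rfl fun d _ => by rw [Finset.sum_mul]
      rw [this, ← Finset.sum_add_distrib, ← Finset.sum_neg_distrib]
      refine Finset.sum_congr rfl fun k _ => ?_
      rw [← Finset.sum_add_distrib, ← Finset.sum_neg_distrib]
      exact Finset.sum_congr rfl fun d _ => by ring
    have e2 : ∀ i, ∑ k, lagWeight β (ν i) k * (p i k).2 = (p i none).2 +
        (∑ j, β j * (p i (some (.inl j))).2 + ∑ k, ν i k * (p i (some (.inr k))).2) := by
      intro i
      rw [Fintype.sum_option, Fintype.sum_sum_type]
      simp [lagWeight]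
    rw [Fintype.sum_sum_type, Fintype.sum_sum_type] at this
    simp only [Sum.elim_inl, Sum.elim_inr, LinearMap.sum_apply,
      LinearMap.neg_apply, LinearMap.sub_apply, Fintype.sum_prod_type, Finset.univ_unique,
      Finset.sum_singleton, PUnit.default_eq_unit, wt, ht, pt, LinearMap.coe_mk, AddHom.coe_mk, Pi.smul_apply,
      Prod.smul_fst, Prod.smul_snd, smul_eq_mul, sub_zero] at this
    have e3 : ∀ i, r i * (∑ k, (dotp (Y i k) (p i k).1 - lagWeight β (ν i) k * (p i k).2) - α)
        = - (r i * (p i none).2) - ∑ j, β j * (r i * (p i (some (.inl j))).2)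
          - ∑ k, ν i k * (r i * (p i (some (.inr k))).2) - α * r i
          - ∑ k : Fin J ⊕ Fin L, ∑ d, m (.inr (i, k, d)) *
            (r i * (p i (some k)).1 d - r i * (p i none).1 d) := by
      intro i
      rw [Finset.sum_sub_distrib, e1, e2]
      have h1 : ∑ j, β j * (r i * (p i (some (.inl j))).2)
          = r i * ∑ j, β j * (p i (some (.inl j))).2 := by
        rw [Finset.mul_sum]
        exact Finset.sum_congr rfl fun _ _ => by ring
      have h2 : ∑ k, ν i k * (r i * (p i (some (.inr k))).2)
          = r i * ∑ k, ν i k * (p i (some (.inr k))).2 := by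
        rw [Finset.mul_sum]
        exact Finset.sum_congr rfl fun _ _ => by ring
      have h3 : ∑ k : Fin J ⊕ Fin L, ∑ d, m (.inr (i, k, d)) *
            (r i * (p i (some k)).1 d - r i * (p i none).1 d)
          = r i * ∑ k : Fin J ⊕ Fin L, ∑ d, m (.inr (i, k, d)) *
            ((p i (some k)).1 d - (p i none).1 d) := by
        rw [Finset.mul_sum]
        refine Finset.sum_congr rfl fun _ _ => ?_
        rw [Finset.mul_sum]
        exact Finset.sum_congr rfl fun _ _ => by ring
      rw [h1, h2, h3]
      ring
    have e4 : ∑ j, a (.inl j) * (∑ i, r i * (p i (some (.inl j))).2 - μ j)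
        = ∑ i, ∑ j, β j * (r i * (p i (some (.inl j))).2) - dotp μ β := by
      rw [Finset.sum_comm, dotp, ← Finset.sum_sub_distrib]
      refine Finset.sum_congr rfl fun j _ => ?_
      rw [← Finset.mul_sum]
      simp only [hβ]
      ring
    rw [Finset.sum_congr rfl fun i _ => e3 i]
    rw [e4] at this
    simp only [Finset.sum_sub_distrib, Finset.sum_neg_distrib] at this ⊢
    rw [← Finset.mul_sum]
    simp only [hν, hα]
    linarith
  have hbase := fun r hr => key (fun i k => (z i, s i k)) (fun i k => (hs i k).1) r hr
  refine ⟨α, β, ν, Y, fun j => ha _, fun i k => ha _, ?_, fun i => ?_, fun i p hp => ?_⟩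
  · have := (nonpos_of_forall_pos_sum_mul_le hbase).1
    linarith
  · rw [Fintype.sum_option]
    funext d
    simp only [hY, Option.elim, Pi.add_apply, Finset.sum_apply, Finset.sum_neg_distrib,
      add_neg_cancel, Pi.zero_apply]
  · have := (nonpos_of_forall_pos_sum_mul_le
      (key (fun i' k => if i' = i then p k else (z i', s i' k)) (fun i' k => by
        split_ifs with h
        · rw [h]
          exact hp k
        · exact (hs i' k).1))).2 i
    simp only [if_true] at this
    linarith

section EpigraphSlices

open Filter Topology

variable {n : ℕ}

/-- An extended-real-valued function that coincides with a real affine function. -/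
def IsRealAffine (F : (Fin n → ℝ) → EReal) : Prop :=
  ∃ (a : (Fin n → ℝ) →ₗ[ℝ] ℝ) (b : ℝ), ∀ x, F x = ((a x + b : ℝ) : EReal)

theorem relIntAt_epigraph {F : (Fin n → ℝ) → EReal} (hF : ConvexFn F) {z : Fin n → ℝ}
    (hz : RelIntAt (edom F) z) {b : ℝ} (hb : F z < b) :
    RelIntAt {p : (Fin n → ℝ) × ℝ | F p.1 ≤ (p.2 : EReal)} (z, b) := by
  refine ⟨hb.le, ?_⟩
  rintro ⟨x, t⟩ hxt
  obtain ⟨b', hzb', hb'⟩ := EReal.lt_iff_exists_real_btwn.1 hb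
  have hb' : b' < b := by exact_mod_cast hb'
  have hx : x ∈ edom F := lt_of_le_of_lt hxt (EReal.coe_lt_top t)
  obtain ⟨e, he, he0⟩ := ((hz.2 x hx).and self_mem_nhdsWithin).exists
  have he0 : 0 < e := he0
  obtain ⟨v, hv, -⟩ := EReal.lt_iff_exists_real_btwn.1 (show F (z + e • (z - x)) < ⊤ from he)
  have hlim : ∀ᶠ ε in 𝓝[>] (0 : ℝ), (1 - ε / e) * b' + ε / e * v < b + ε * (b - t) := by
    refine Filter.Eventually.filter_mono nhdsWithin_le_nhds ?_
    refine ContinuousAt.eventually_lt (by fun_prop) (by fun_prop) ?_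
    simpa using hb'
  have hsmall : ∀ᶠ ε in 𝓝[>] (0 : ℝ), ε < e :=
    Filter.Eventually.filter_mono nhdsWithin_le_nhds (eventually_lt_nhds he0)
  filter_upwards [hlim, hsmall, self_mem_nhdsWithin] with ε h1 h2 h3
  have h3 : 0 < ε := h3
  have hmem := hF (x := (z, b')) hzb'.le (y := (z + e • (z - x), v)) hv.le
    (a := 1 - ε / e) (b := ε / e) (sub_nonneg.2 ((div_le_one he0).2 h2.le)) (by positivity)
    (by ring)
  have hpt : (1 - ε / e) • z + (ε / e) • (z + e • (z - x)) = z + ε • (z - x) := by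
    have : ε / e * e = ε := div_mul_cancel₀ _ he0.ne'
    rw [smul_add, smul_smul, this, sub_smul, one_smul]
    abel
  have hmem' : F ((1 - ε / e) • z + (ε / e) • (z + e • (z - x))) ≤
      (((1 - ε / e) * b' + ε / e * v : ℝ) : EReal) := hmem
  rw [hpt] at hmem'
  exact hmem'.trans (by exact_mod_cast h1.le)

theorem exists_epi_slice {F : (Fin n → ℝ) → EReal} (hF : ConvexFn F) {z : Fin n → ℝ}
    (hz : RelIntAt (edom F) z) {b : ℝ} (hb : F z ≤ b) (hb' : IsRealAffine F ∨ F z < b) :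
    ∃ (A : Set ((Fin n → ℝ) × ℝ)) (s : ℝ), Convex ℝ A ∧ RelIntAt A (z, s) ∧ s ≤ b ∧
      (∀ p ∈ A, F p.1 ≤ (p.2 : EReal)) ∧ ∀ x (f : ℝ), F x = f → (x, f) ∈ A := by
  rcases hb' with ⟨a, c, hac⟩ | hlt
  · refine ⟨{p | p.2 = a p.1 + c}, a z + c, ?_, ⟨rfl, ?_⟩, ?_, ?_, ?_⟩
    · rintro ⟨x, s⟩ (hx : s = a x + c) ⟨y, t⟩ (hy : t = a y + c) u v hu hv huv
      change u * s + v * t = a (u • x + v • y) + c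
      rw [hx, hy, map_add, map_smul, map_smul, smul_eq_mul, smul_eq_mul]
      linear_combination c * huv
    · rintro ⟨x, t⟩ (hx : t = a x + c)
      refine Filter.Eventually.of_forall fun ε => ?_
      change (a z + c) + ε * (a z + c - t) = a (z + ε • (z - x)) + c
      rw [hx, map_add, map_smul, map_sub, smul_eq_mul]
      ring
    · rw [hac] at hb
      exact_mod_cast hb
    · rintro ⟨x, t⟩ (hx : t = a x + c)
      rw [hac, hx]
    · intro x f hf
      rw [hac] at hf
      exact (EReal.coe_injective hf).symm
  · exact ⟨_, b, hF, relIntAt_epigraph hF hz hlt, le_rfl, fun p hp => hp, fun x f hf => hf.le⟩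

theorem relIntAt_of_mem_intrinsicInterior {E : Type*} [NormedAddCommGroup E] [NormedSpace ℝ E]
    {D : Set E} {r : E} (hr : r ∈ intrinsicInterior ℝ D) : RelIntAt D r := by
  refine ⟨intrinsicInterior_subset hr, fun x hx => ?_⟩
  obtain ⟨y, hy, rfl⟩ := mem_intrinsicInterior.1 hr
  let γ : ℝ → affineSpan ℝ D := fun ε =>
    ⟨AffineMap.lineMap (y : E) x (-ε), AffineMap.lineMap_mem _ y.2 (subset_affineSpan ℝ D hx)⟩
  have hγ : Continuous γ := by
    refine Continuous.subtype_mk ?_ _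
    exact AffineMap.lineMap_continuous.comp continuous_neg
  have h0 : γ 0 = y := Subtype.ext (by simp [γ])
  have hev : ∀ᶠ ε in 𝓝 (0 : ℝ), γ ε ∈ interior ((↑) ⁻¹' D : Set (affineSpan ℝ D)) :=
    hγ.continuousAt.eventually_mem (by rw [h0]; exact isOpen_interior.mem_nhds hy)
  filter_upwards [hev.filter_mono nhdsWithin_le_nhds] with ε hε
  have h1 : γ ε ∈ ((↑) ⁻¹' D : Set (affineSpan ℝ D)) := interior_subset hε
  have h1 : ((γ ε : affineSpan ℝ D) : E) ∈ D := h1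
  convert h1 using 1
  simp only [γ, AffineMap.lineMap_apply, vsub_eq_sub, vadd_eq_add]
  module

theorem relIntAt_edom_of_intrinsicInterior {I J : ℕ}
    {r : (Fin I → ℝ) × (Fin I → ℝ) × (Fin I → Fin J → ℝ) × (Fin I → Fin n → ℝ)}
    {G : (Fin I → ℝ) × (Fin I → ℝ) × (Fin I → Fin J → ℝ) × (Fin I → Fin n → ℝ) → EReal}
    {F : (Fin n → ℝ) → EReal} {i : Fin I} (hi : 0 < r.2.1 i)
    (hG : ∀ s, s.2.1 i = r.2.1 i → (G s < ⊤ ↔ F ((r.2.1 i)⁻¹ • s.2.2.2 i) < ⊤))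
    (hr : r ∈ intrinsicInterior ℝ {s | G s < ⊤}) :
    RelIntAt (edom F) ((r.2.1 i)⁻¹ • r.2.2.2 i) := by
  obtain ⟨hr0, hr1⟩ := relIntAt_of_mem_intrinsicInterior hr
  refine ⟨(hG r rfl).1 hr0, fun x hx => ?_⟩
  have hp := hr1 (r.1, r.2.1, r.2.2.1, Function.update r.2.2.2 i (r.2.1 i • x)) (by
    refine (hG (r.1, r.2.1, r.2.2.1, Function.update r.2.2.2 i (r.2.1 i • x)) rfl).2 ?_
    simpa [smul_smul, inv_mul_cancel₀ hi.ne'] using (show F x < ⊤ from hx))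
  filter_upwards [hp] with ε hε
  have h1 := (hG _ (by simp)).1 hε
  have h2 : (r.2.1 i)⁻¹ • (r.2.2.2 i + ε • (r.2.2.2 i - r.2.1 i • x)) =
      (r.2.1 i)⁻¹ • r.2.2.2 i + ε • ((r.2.1 i)⁻¹ • r.2.2.2 i - x) := by
    rw [smul_add, smul_comm _ ε, smul_sub, smul_smul, inv_mul_cancel₀ hi.ne', one_smul]
  rw [← h2]
  change F _ < ⊤
  simpa using h1

theorem isRealAffine_of_isAffineCLM {I J : ℕ}
    {G : (Fin I → ℝ) × (Fin I → ℝ) × (Fin I → Fin J → ℝ) × (Fin I → Fin n → ℝ) → EReal}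
    {F : (Fin n → ℝ) → EReal}
    (hGF : ∀ x, G (0, fun _ => 1, 0, fun _ => x) = F x) (hG : IsAffineCLM G) :
    IsRealAffine F := by
  obtain ⟨a, b, hab⟩ := hG
  let ι : (Fin n → ℝ) →ₗ[ℝ]
      (Fin I → ℝ) × (Fin I → ℝ) × (Fin I → Fin J → ℝ) × (Fin I → Fin n → ℝ) :=
    { toFun := fun x => (0, 0, 0, fun _ => x)
      map_add' := fun x y => by ext <;> simp
      map_smul' := fun t x => by ext <;> simp }
  refine ⟨a.toLinearMap ∘ₗ ι, a (0, fun _ => 1, 0, 0) + b, fun x => ?_⟩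
  rw [← hGF, hab]
  have : ((0, fun _ => 1, 0, fun _ => x) :
      (Fin I → ℝ) × (Fin I → ℝ) × (Fin I → Fin J → ℝ) × (Fin I → Fin n → ℝ)) =
      ι x + (0, fun _ => 1, 0, 0) := by ext <;> simp [ι]
  rw [this, map_add, add_assoc]
  rfl

end EpigraphSlices

section Conjugates

variable {n : ℕ}

theorem dotp_comm (x y : Fin n → ℝ) : dotp x y = dotp y x :=
  Finset.sum_congr rfl fun _ _ => mul_comm _ _

theorem dotp_add_left (x y w : Fin n → ℝ) : dotp (x + y) w = dotp x w + dotp y w := by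
  simp [dotp, add_mul, Finset.sum_add_distrib]

theorem dotp_smul_left (t : ℝ) (x w : Fin n → ℝ) : dotp (t • x) w = t * dotp x w := by
  simp [dotp, Finset.mul_sum, mul_assoc]

theorem dotp_add_right (w x y : Fin n → ℝ) : dotp w (x + y) = dotp w x + dotp w y := by
  rw [dotp_comm, dotp_add_left, dotp_comm x, dotp_comm y]

theorem dotp_smul_right (t : ℝ) (w x : Fin n → ℝ) : dotp w (t • x) = t * dotp w x := by
  rw [dotp_comm, dotp_smul_left, dotp_comm x]

theorem dotp_sum_left {κ : Type*} (s : Finset κ) (x : κ → Fin n → ℝ) (w : Fin n → ℝ) :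
    dotp (∑ k ∈ s, x k) w = ∑ k ∈ s, dotp (x k) w := by
  simp only [dotp, Finset.sum_apply, Finset.sum_mul]
  exact Finset.sum_comm

theorem EReal.coe_finset_sum {κ : Type*} (s : Finset κ) (f : κ → ℝ) :
    ((∑ k ∈ s, f k : ℝ) : EReal) = ∑ k ∈ s, (f k : EReal) := by
  induction s using Finset.cons_induction with
  | empty => simp
  | cons a s ha ih => rw [Finset.sum_cons, Finset.sum_cons, EReal.coe_add, ih]

theorem nonpos_of_forall_nonneg_mul_le {a M : ℝ} (h : ∀ s : ℝ, 0 ≤ s → s * a ≤ M) : a ≤ 0 := by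
  by_contra! ha
  have h0 := h 0 le_rfl
  have := h ((M + 1) / a) (div_nonneg (by linarith) ha.le)
  rw [div_mul_cancel₀ _ ha.ne'] at this
  linarith

theorem conjFn_le {F : (Fin n → ℝ) → EReal} (hF : ∀ x, F x ≠ ⊥) {w : Fin n → ℝ} {σ : ℝ}
    (h : ∀ x (f : ℝ), F x = f → dotp w x - f ≤ σ) : conjFn F w ≤ σ := by
  refine iSup_le fun x => ?_
  induction hx : F x with
  | bot => exact absurd hx (hF x)
  | top => simp
  | coe f => exact_mod_cast h x f hx

theorem sub_le_conjFn {F : (Fin n → ℝ) → EReal} (w x : Fin n → ℝ) {f : ℝ} (hf : F x ≤ f) :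
    ((dotp w x - f : ℝ) : EReal) ≤ conjFn F w := by
  refine le_trans ?_ (le_iSup (fun x => ((dotp w x : ℝ) : EReal) - F x) x)
  rw [EReal.coe_sub]
  exact EReal.sub_le_sub le_rfl hf

theorem conjFn_ne_bot {F : (Fin n → ℝ) → EReal} {x : Fin n → ℝ} (hx : F x < ⊤)
    (w : Fin n → ℝ) : conjFn F w ≠ ⊥ := by
  obtain ⟨f, hf, -⟩ := EReal.lt_iff_exists_real_btwn.1 hx
  exact ((EReal.bot_lt_coe _).trans_le (sub_le_conjFn w x hf.le)).ne'

theorem exists_conjFn_lt_top {F : (Fin n → ℝ) → EReal} (hF : ConvexFn F) (hb : ∀ x, F x ≠ ⊥)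
    {z : Fin n → ℝ} (hz : RelIntAt (edom F) z) : ∃ w, conjFn F w < ⊤ := by
  have hz' : F z < ⊤ := hz.1
  obtain ⟨f, hf⟩ : ∃ f : ℝ, F z = f := ⟨(F z).toReal, (EReal.coe_toReal hz'.ne (hb z)).symm⟩
  have hri := relIntAt_epigraph hF hz (b := f + 1) (by rw [hf]; exact_mod_cast lt_add_one f)
  let e : Fin n → ((Fin n → ℝ) × ℝ) →ₗ[ℝ] ℝ := fun d =>
    LinearMap.proj d ∘ₗ LinearMap.fst ℝ (Fin n → ℝ) ℝ
  obtain ⟨_, m, -, hm⟩ := exists_multipliers_ineq_eq (κ := Empty) hF hri (fun k => k.elim)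
    (fun k => k.elim) (fun k => k.elim) e z (fun _ => rfl)
    (-LinearMap.snd ℝ (Fin n → ℝ) ℝ) (-f) (by
      rintro ⟨x, t⟩ hx - hxz
      have hxz : x = z := funext hxz
      have hx : F x ≤ t := hx
      rw [hxz, hf] at hx
      simpa using hx)
  refine ⟨-m, lt_of_le_of_lt (conjFn_le (σ := - f - dotp m z) hb fun x t hxt => ?_)
    (EReal.coe_lt_top _)⟩
  have := hm (x, t) hxt.le
  simp only [Finset.univ_eq_empty, Finset.sum_empty, LinearMap.neg_apply, e,
    LinearMap.comp_apply, LinearMap.proj_apply, LinearMap.fst_apply, LinearMap.snd_apply,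
    mul_sub, Finset.sum_sub_distrib] at this
  have h1 : dotp (-m) x = - dotp m x := by simp [dotp]
  rw [h1]
  simp only [dotp]
  linarith

theorem exists_sum_le_of_forall_sum_le {κ : Type*} [Fintype κ] {X : κ → Type*}
    [∀ k, Nonempty (X k)] (f : ∀ k, X k → ℝ) {α : ℝ}
    (h : ∀ x : ∀ k, X k, ∑ k, f k (x k) ≤ α) :
    ∃ σ : κ → ℝ, (∀ k x, f k x ≤ σ k) ∧ ∑ k, σ k ≤ α := by
  have hbdd : ∀ k, BddAbove (Set.range (f k)) := by
    intro k
    let x₀ : ∀ k, X k := fun k => Classical.arbitrary _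
    refine ⟨α - ∑ k' ∈ Finset.univ.erase k, f k' (x₀ k'), ?_⟩
    rintro _ ⟨x, rfl⟩
    have h1 := h (Function.update x₀ k x)
    rw [← Finset.add_sum_erase _ _ (Finset.mem_univ k), Function.update_self] at h1
    have h2 : ∑ k' ∈ Finset.univ.erase k, f k' (Function.update x₀ k x k') =
        ∑ k' ∈ Finset.univ.erase k, f k' (x₀ k') :=
      Finset.sum_congr rfl fun k' hk' => by rw [Function.update_of_ne (Finset.ne_of_mem_erase hk')]
    linarith
  refine ⟨fun k => ⨆ x, f k x, fun k x => le_ciSup (hbdd k) x, ?_⟩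
  refine le_of_forall_pos_le_add fun ε hε => ?_
  have hδ : 0 < ε / (Fintype.card κ + 1) := by positivity
  choose x hx using fun k => exists_lt_of_lt_ciSup (sub_lt_self (⨆ x, f k x) hδ)
  have h1 : ∑ k, (⨆ x, f k x) ≤ ∑ k, (f k (x k) + ε / (Fintype.card κ + 1)) :=
    Finset.sum_le_sum fun k _ => by linarith [hx k]
  rw [Finset.sum_add_distrib, Finset.sum_const, Finset.card_univ, nsmul_eq_mul] at h1
  have h2 : (Fintype.card κ : ℝ) * (ε / (Fintype.card κ + 1)) ≤ ε := by
    rw [mul_div_assoc', div_le_iff₀ (by positivity)]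
    nlinarith
  linarith [h x]

theorem persp_conjFn_le {F : (Fin n → ℝ) → EReal} (hb : ∀ x, F x ≠ ⊥) {x₀ : Fin n → ℝ}
    (hx₀ : F x₀ < ⊤) (hw : ∃ w, conjFn F w < ⊤) {Y : Fin n → ℝ} {W σ : ℝ} (hW : 0 ≤ W)
    (h : ∀ x (f : ℝ), F x = f → dotp Y x - W * f ≤ σ) : persp (conjFn F) Y W ≤ σ := by
  rcases hW.eq_or_lt with rfl | hW
  · rw [persp, if_neg (lt_irrefl _)]
    refine iSup₂_le fun x (hx : conjFn (conjFn F) x < ⊤) => ?_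
    obtain ⟨w, hw⟩ := hw
    obtain ⟨c, hc⟩ : ∃ c : ℝ, conjFn F w = c :=
      ⟨_, (EReal.coe_toReal hw.ne (conjFn_ne_bot hx₀ w)).symm⟩
    obtain ⟨M, hM, -⟩ := EReal.lt_iff_exists_real_btwn.1 hx
    have key : ∀ s : ℝ, 0 ≤ s → s * (dotp x Y - σ) ≤ M + c - dotp x w := by
      intro s hs
      have h1 : conjFn F (w + s • Y) ≤ ((c + s * σ : ℝ) : EReal) := by
        refine conjFn_le hb fun y f hf => ?_
        have h2 := sub_le_conjFn w y hf.le
        rw [hc] at h2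
        have h2 : dotp w y - f ≤ c := by exact_mod_cast h2
        have h3 := mul_le_mul_of_nonneg_left (h y f hf) hs
        rw [dotp_add_left, dotp_smul_left]
        linarith
      have h2 := (sub_le_conjFn x (w + s • Y) h1).trans hM.le
      have h2 : dotp x (w + s • Y) - (c + s * σ) ≤ M := by exact_mod_cast h2
      rw [dotp_add_right, dotp_smul_right] at h2
      linarith
    have := nonpos_of_forall_nonneg_mul_le key
    exact_mod_cast (sub_nonpos.1 this)
  · rw [persp, if_pos hW]
    have h1 : conjFn F (W⁻¹ • Y) ≤ ((W⁻¹ * σ : ℝ) : EReal) := by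
      refine conjFn_le hb fun x f hf => ?_
      have := mul_le_mul_of_nonneg_left (h x f hf) (inv_nonneg.2 hW.le)
      rw [mul_sub, inv_mul_cancel_left₀ hW.ne'] at this
      rwa [dotp_smul_left]
    calc (W : EReal) * conjFn F (W⁻¹ • Y) ≤ (W : EReal) * ((W⁻¹ * σ : ℝ) : EReal) :=
          mul_le_mul_of_nonneg_left h1 (by exact_mod_cast hW.le)
      _ = σ := by rw [← EReal.coe_mul, mul_inv_cancel_left₀ hW.ne']

theorem suppFn_conjFn_le {F : (Fin n → ℝ) → EReal} {x₀ v : Fin n → ℝ} (hx₀ : F x₀ < ⊤) {ω : ℝ}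
    (hv : suppFn (edom (conjFn F)) v ≤ ω) {y : Fin n → ℝ} {b : ℝ} (hb : 0 ≤ b)
    (hy : persp (conjFn F) y b < ⊤) : dotp y v ≤ b * ω := by
  have hv' : ∀ w, conjFn F w < ⊤ → dotp w v ≤ ω := fun w hw => by
    have := (le_iSup₂ (f := fun x (_ : x ∈ edom (conjFn F)) => ((dotp x v : ℝ) : EReal)) w
      hw).trans hv
    exact_mod_cast this
  rcases hb.eq_or_lt with rfl | hb
  · rw [persp, if_neg (lt_irrefl _)] at hy
    obtain ⟨M, hM, -⟩ := EReal.lt_iff_exists_real_btwn.1 hy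
    obtain ⟨f, hf, -⟩ := EReal.lt_iff_exists_real_btwn.1 hx₀
    rw [zero_mul]
    refine nonpos_of_forall_nonneg_mul_le (M := M - dotp y x₀) fun s hs => ?_
    have hmem : x₀ + s • v ∈ edom (conjFn (conjFn F)) := by
      refine lt_of_le_of_lt (conjFn_le (σ := f + s * ω) (conjFn_ne_bot hx₀) fun w c hc => ?_)
        (EReal.coe_lt_top _)
      have h1 := sub_le_conjFn w x₀ hf.le
      rw [hc] at h1
      have h1 : dotp w x₀ - f ≤ c := by exact_mod_cast h1
      have h2 := mul_le_mul_of_nonneg_left (hv' w (by rw [hc]; exact EReal.coe_lt_top c)) hs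
      rw [dotp_add_left, dotp_smul_left, dotp_comm, dotp_comm v]
      linarith
    have h1 := (le_iSup₂ (f := fun x (_ : x ∈ edom (conjFn (conjFn F))) =>
      ((dotp x y : ℝ) : EReal)) _ hmem).trans hM.le
    have h1 : dotp (x₀ + s • v) y ≤ M := by exact_mod_cast h1
    rw [dotp_add_left, dotp_smul_left, dotp_comm, dotp_comm v] at h1
    linarith
  · rw [persp, if_pos hb] at hy
    have hlt : conjFn F (b⁻¹ • y) < ⊤ := by
      refine lt_top_iff_ne_top.2 fun htop => ?_
      rw [htop, EReal.coe_mul_top_of_pos hb] at hy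
      exact lt_irrefl _ hy
    have := mul_le_mul_of_nonneg_left (hv' _ hlt) hb.le
    rwa [dotp_smul_left, mul_inv_cancel_left₀ hb.ne'] at this

/-- Fenchel's inequality for the perspective of the conjugate. -/
theorem sub_le_persp_conjFn {F : (Fin n → ℝ) → EReal} (y x : Fin n → ℝ)
    {b : ℝ} (hb : 0 ≤ b) {f : ℝ} (hf : F x ≤ f) :
    ((dotp y x - b * f : ℝ) : EReal) ≤ persp (conjFn F) y b := by
  rcases hb.eq_or_lt with rfl | hb
  · rw [persp, if_neg (lt_irrefl _), zero_mul, sub_zero, dotp_comm]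
    refine le_iSup₂ (f := fun x (_ : x ∈ edom (conjFn (conjFn F))) =>
      ((dotp x y : ℝ) : EReal)) x ?_
    refine lt_of_le_of_lt (conjFn_le (σ := f) (conjFn_ne_bot (x := x)
      (hf.trans_lt (EReal.coe_lt_top f))) fun w c hc => ?_) (EReal.coe_lt_top _)
    have h1 := sub_le_conjFn w x hf
    rw [hc] at h1
    have h1 : dotp w x - f ≤ c := by exact_mod_cast h1
    rw [dotp_comm]
    linarith
  · rw [persp, if_pos hb]
    have h1 := mul_le_mul_of_nonneg_left (sub_le_conjFn (b⁻¹ • y) x hf)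
      (show (0 : EReal) ≤ (b : EReal) by exact_mod_cast hb.le)
    rwa [← EReal.coe_mul, mul_sub, dotp_smul_left, mul_inv_cancel_left₀ hb.ne'] at h1

end Conjugates

section StrongDuality

section ERealScaling

variable {l : ℝ}

theorem EReal.coe_mul_lt_top_iff (hl : 0 < l) (x : EReal) : (l : EReal) * x < ⊤ ↔ x < ⊤ := by
  induction x with
  | bot => simp [EReal.coe_mul_bot_of_pos hl]
  | top => simp [EReal.coe_mul_top_of_pos hl]
  | coe x => rw [← EReal.coe_mul]; simp only [EReal.coe_lt_top]

theorem EReal.coe_mul_sub_lt_top_iff (hl : 0 < l) (x : EReal) (w : ℝ) :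
    (l : EReal) * x - w < ⊤ ↔ x < ⊤ := by
  induction x with
  | bot => simp [EReal.coe_mul_bot_of_pos hl]
  | top => simp [EReal.coe_mul_top_of_pos hl]
  | coe x => rw [← EReal.coe_mul, ← EReal.coe_sub]; simp only [EReal.coe_lt_top]

theorem EReal.coe_sub_coe_mul_lt_top_iff (hl : 0 < l) (x : EReal) (t : ℝ) :
    (t : EReal) - l * x < ⊤ ↔ -x < ⊤ := by
  induction x with
  | bot => simp [EReal.coe_mul_bot_of_pos hl]
  | top => simp [EReal.coe_mul_top_of_pos hl]
  | coe x =>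
    rw [← EReal.coe_mul, ← EReal.coe_sub, ← EReal.coe_neg]; simp only [EReal.coe_lt_top]

theorem EReal.coe_mul_sub_nonpos_iff (hl : 0 < l) (x : EReal) (w : ℝ) :
    (l : EReal) * x - w ≤ 0 ↔ x ≤ ((w / l : ℝ) : EReal) := by
  induction x with
  | bot => simp [EReal.coe_mul_bot_of_pos hl]
  | top => simp [EReal.coe_mul_top_of_pos hl]
  | coe x =>
    rw [← EReal.coe_mul, ← EReal.coe_sub, EReal.coe_le_coe_iff, le_div_iff₀ hl, mul_comm x l]
    norm_cast
    exact _root_.sub_nonpos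

theorem EReal.coe_mul_sub_neg_iff (hl : 0 < l) (x : EReal) (w : ℝ) :
    (l : EReal) * x - w < 0 ↔ x < ((w / l : ℝ) : EReal) := by
  induction x with
  | bot => simp [EReal.coe_mul_bot_of_pos hl, EReal.bot_lt_coe]
  | top => simp [EReal.coe_mul_top_of_pos hl]
  | coe x =>
    rw [← EReal.coe_mul, ← EReal.coe_sub, EReal.coe_lt_coe_iff, lt_div_iff₀ hl, mul_comm x l]
    norm_cast
    exact _root_.sub_neg

theorem EReal.coe_sub_coe_mul_nonpos_iff (hl : 0 < l) (x : EReal) (t : ℝ) :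
    (t : EReal) - l * x ≤ 0 ↔ -x ≤ ((-t / l : ℝ) : EReal) := by
  induction x with
  | bot => simp [EReal.coe_mul_bot_of_pos hl]
  | top => simp [EReal.coe_mul_top_of_pos hl]
  | coe x =>
    rw [← EReal.coe_mul, ← EReal.coe_sub, ← EReal.coe_neg, EReal.coe_le_coe_iff, le_div_iff₀ hl]
    norm_cast
    constructor <;> intro <;> linarith

theorem EReal.coe_sub_coe_mul_neg_iff (hl : 0 < l) (x : EReal) (t : ℝ) :
    (t : EReal) - l * x < 0 ↔ -x < ((-t / l : ℝ) : EReal) := by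
  induction x with
  | bot => simp [EReal.coe_mul_bot_of_pos hl]
  | top => simp [EReal.coe_mul_top_of_pos hl, EReal.bot_lt_coe]
  | coe x =>
    rw [← EReal.coe_mul, ← EReal.coe_sub, ← EReal.coe_neg, EReal.coe_lt_coe_iff, lt_div_iff₀ hl]
    norm_cast
    constructor <;> intro <;> linarith

end ERealScaling

/-- The convex functions entering the `i`-th block of the reformulated problems. -/
def blockFn {dz I J L : ℕ} (gi : Fin I → (Fin dz → ℝ) → EReal)
    (c : Fin L → (Fin dz → ℝ) → EReal) (h : Fin J → (Fin dz → ℝ) → EReal) (i : Fin I) :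
    Option (Fin J ⊕ Fin L) → (Fin dz → ℝ) → EReal
  | none => fun z => - gi i z
  | some (.inl j) => h j
  | some (.inr ℓ) => c ℓ

/-- Upper bounds on `blockFn` corresponding to the variables `τ_i`, `λ_i`, `ω_i`. -/
def blockBound {J L : ℕ} (t l : ℝ) (w : Fin J → ℝ) : Option (Fin J ⊕ Fin L) → ℝ
  | none => -t / l
  | some (.inl j) => w j / l
  | some (.inr _) => 0

section

variable {gi : Fin I → (Fin dz → ℝ) → EReal} {c : Fin L → (Fin dz → ℝ) → EReal}
  {h : Fin J → (Fin dz → ℝ) → EReal} {μ : Fin J → ℝ}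

theorem blockFn_ne_bot (hG : AssumptionG gi) (hC : AssumptionC c) (hH : AssumptionH h)
    (i : Fin I) (k : Option (Fin J ⊕ Fin L)) (x : Fin dz → ℝ) : blockFn gi c h i k x ≠ ⊥ := by
  rcases k with _ | j | ℓ
  exacts [(hG i).1.1 x, (hH j).1.1 x, (hC ℓ).1.1 x]

theorem convexFn_blockFn (hG : AssumptionG gi) (hC : AssumptionC c) (hH : AssumptionH h)
    (i : Fin I) (k : Option (Fin J ⊕ Fin L)) : ConvexFn (blockFn gi c h i k) := by
  rcases k with _ | j | ℓ
  exacts [(hG i).2.2, (hH j).2.2, (hC ℓ).2.2]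

theorem SlaterADBP.block {r : (Fin I → ℝ) × (Fin I → ℝ) × (Fin I → Fin J → ℝ) ×
      (Fin I → Fin dz → ℝ)} (hr : SlaterADBP gi c h μ r) {i : Fin I} (hi : 0 < r.2.1 i)
    (k : Option (Fin J ⊕ Fin L)) :
    RelIntAt (edom (blockFn gi c h i k)) ((r.2.1 i)⁻¹ • r.2.2.2 i) ∧
    blockFn gi c h i k ((r.2.1 i)⁻¹ • r.2.2.2 i) ≤
      (blockBound (r.1 i) (r.2.1 i) (r.2.2.1 i) k : ℝ) ∧
    (IsRealAffine (blockFn gi c h i k) ∨ blockFn gi c h i k ((r.2.1 i)⁻¹ • r.2.2.2 i) <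
      (blockBound (r.1 i) (r.2.1 i) (r.2.2.1 i) k : ℝ)) := by
  obtain ⟨riC, riH, riG, ⟨-, -, -, hfC, hfH, hfG⟩, hsC, hsH, hsG⟩ := hr
  rcases k with _ | j | ℓ
  · refine ⟨relIntAt_edom_of_intrinsicInterior hi (fun s hs => ?_) (riG i), ?_, ?_⟩
    · rw [adbpConG, cpersp, hs, if_pos hi, EReal.coe_sub_coe_mul_lt_top_iff hi]
      rfl
    · have := hfG i
      rwa [adbpConG, cpersp, if_pos hi, EReal.coe_sub_coe_mul_nonpos_iff hi] at this
    · by_cases ha : IsAffineCLM (adbpConG (dz := dz) (J := J) (L := L) gi i)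
      · refine Or.inl (isRealAffine_of_isAffineCLM (fun x => ?_) ha)
        simp [adbpConG, cpersp, blockFn]
      · have := hsG i ha
        rw [adbpConG, cpersp, if_pos hi, EReal.coe_sub_coe_mul_neg_iff hi] at this
        exact Or.inr this
  · refine ⟨relIntAt_edom_of_intrinsicInterior hi (fun s hs => ?_) (riH i j), ?_, ?_⟩
    · rw [adbpConH, persp, hs, if_pos hi, EReal.coe_mul_sub_lt_top_iff hi]
      rfl
    · have := hfH i j
      rwa [adbpConH, persp, if_pos hi, EReal.coe_mul_sub_nonpos_iff hi] at this
    · by_cases ha : IsAffineCLM (adbpConH (dz := dz) (L := L) h i j)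
      · refine Or.inl (isRealAffine_of_isAffineCLM (fun x => ?_) ha)
        simp [adbpConH, persp, blockFn]
      · have := hsH i j ha
        rw [adbpConH, persp, if_pos hi, EReal.coe_mul_sub_neg_iff hi] at this
        exact Or.inr this
  · refine ⟨relIntAt_edom_of_intrinsicInterior hi (fun s hs => ?_) (riC i ℓ), ?_, ?_⟩
    · rw [adbpConC, persp, hs, if_pos hi, EReal.coe_mul_lt_top_iff hi]
      rfl
    · have := hfC i ℓ
      rw [adbpConC, persp, if_pos hi] at this
      simpa [blockFn, blockBound, this] using
        EReal.coe_mul_sub_nonpos_iff hi (c ℓ ((r.2.1 i)⁻¹ • r.2.2.2 i)) 0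
    · by_cases ha : IsAffineCLM (adbpConC (dz := dz) (J := J) c i ℓ)
      · refine Or.inl (isRealAffine_of_isAffineCLM (fun x => ?_) ha)
        simp [adbpConC, persp, blockFn]
      · have := hsC i ℓ ha
        rw [adbpConC, persp, if_pos hi] at this
        refine Or.inr ?_
        simpa [blockFn, blockBound, this] using
          EReal.coe_mul_sub_neg_iff hi (c ℓ ((r.2.1 i)⁻¹ • r.2.2.2 i)) 0

theorem adbFeas_nonempty {r : (Fin I → ℝ) × (Fin I → ℝ) × (Fin I → Fin J → ℝ) ×
      (Fin I → Fin dz → ℝ)} (hr : SlaterADBP gi c h μ r) (hpos : ∀ i, 0 < r.2.1 i) :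
    (adbFeas gi c h μ).Nonempty := by
  refine ⟨(fun i => ((r.2.1 i)⁻¹ • r.2.2.2 i, fun j => r.2.2.1 i j / r.2.1 i,
    -(-r.1 i / r.2.1 i)), r.2.1), fun i => ⟨fun ℓ => (hr.block (hpos i) (some (.inr ℓ))).2.1,
    fun j => (hr.block (hpos i) (some (.inl j))).2.1, ?_⟩, hr.2.2.2.1.2.2.1, hr.2.2.2.1.1,
    fun j => ?_⟩
  · have h1 : - gi i _ ≤ _ := (hr.block (hpos i) none).2.1
    simpa [blockBound] using EReal.neg_le.1 h1
  · refine le_trans (Finset.sum_le_sum fun i _ => ?_) (hr.2.2.2.1.2.1 j)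
    exact (mul_div_cancel₀ _ (hpos i).ne').le

theorem exists_mem_apwpFeas_of_adb_le (hG : AssumptionG gi) (hC : AssumptionC c)
    (hH : AssumptionH h) {r : (Fin I → ℝ) × (Fin I → ℝ) × (Fin I → Fin J → ℝ) ×
      (Fin I → Fin dz → ℝ)} (hr : SlaterADBP gi c h μ r) (hpos : ∀ i, 0 < r.2.1 i) {V : ℝ}
    (hV : ∀ p ∈ adbFeas gi c h μ, ∑ i, p.2 i * (p.1 i).2.2 ≤ V) :
    ∃ q ∈ apwpFeas gi c h, q.1 + dotp μ q.2.1 ≤ V := by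
  have hl1 : ∑ i, r.2.1 i = 1 := hr.2.2.2.1.1
  have hωμ := hr.2.2.2.1.2.1
  have : Nonempty (Fin I) := by
    by_contra hne
    rw [not_nonempty_iff] at hne
    simp at hl1
  choose A s hA hs hsb hAF hFA using fun i k =>
    exists_epi_slice (convexFn_blockFn hG hC hH i k) (hr.block (hpos i) k).1
      (hr.block (hpos i) k).2.1 (hr.block (hpos i) k).2.2
  obtain ⟨α, β, ν, Y, hβ, hν, hval, hY, hsum⟩ := exists_mixture_multipliers hA hs hpos hl1
    (μ := μ) (V := V)
    (fun j => by
      refine le_trans (Finset.sum_le_sum fun i _ => ?_) (hωμ j)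
      have := mul_le_mul_of_nonneg_left (hsb i (some (.inl j))) (hpos i).le
      rwa [blockBound, mul_div_cancel₀ _ (hpos i).ne'] at this)
    (fun i k => hsb i (some (.inr k)))
    (fun l w u hl hl1 hmem hμ hc => by
      refine hV (fun i => (w i, fun j => u i (some (.inl j)), -(u i none)), l)
        ⟨fun i => ⟨fun ℓ => ?_, fun j => hAF i _ _ (hmem i (some (.inl j))), ?_⟩,
          fun i => (hl i).le, hl1, hμ⟩
      · exact (hAF i _ _ (hmem i (some (.inr ℓ)))).trans (by exact_mod_cast hc i ℓ)
      · have h1 : - gi i (w i) ≤ (u i none : EReal) := hAF i _ _ (hmem i none)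
        simpa using EReal.neg_le.1 h1)
  refine ⟨(α, β, fun i => Y i none, fun i j => Y i (some (.inl j)),
    fun i ℓ => Y i (some (.inr ℓ)), ν), ⟨fun i => ?_, fun i => ?_, hβ, hν⟩, hval⟩
  · have hne : ∀ k, Nonempty (A i k) := fun k => ⟨⟨_, (hs i k).1⟩⟩
    obtain ⟨σ, hσ, hσα⟩ := exists_sum_le_of_forall_sum_le (X := fun k => A i k)
      (fun k p => dotp (Y i k) p.1.1 - lagWeight β (ν i) k * p.1.2)
      (fun p => hsum i (fun k => p k) fun k => (p k).2)
    have hb := blockFn_ne_bot hG hC hH i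
    have hpersp : ∀ k, 0 ≤ lagWeight β (ν i) k →
        persp (conjFn (blockFn gi c h i k)) (Y i k) (lagWeight β (ν i) k) ≤ σ k := fun k hk =>
      persp_conjFn_le (hb k) (hr.block (hpos i) k).1.1
        (exists_conjFn_lt_top (convexFn_blockFn hG hC hH i k) (hb k) (hr.block (hpos i) k).1)
        hk fun x f hf => hσ k ⟨(x, f), hFA i k x f hf⟩
    have h0 : conjFn (fun z => - gi i z) (Y i none) ≤ σ none := by
      simpa [persp, lagWeight, blockFn] using hpersp none (by simp [lagWeight])
    have hle : conjFn (fun z => - gi i z) (Y i none)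
        + ∑ j, persp (conjFn (h j)) (Y i (some (.inl j))) (β j)
        + ∑ ℓ, persp (conjFn (c ℓ)) (Y i (some (.inr ℓ))) (ν i ℓ) ≤ (α : EReal) := by
      refine le_trans (add_le_add (add_le_add h0 (Finset.sum_le_sum fun j _ =>
        hpersp (some (.inl j)) (hβ j))) (Finset.sum_le_sum fun ℓ _ =>
        hpersp (some (.inr ℓ)) (hν i ℓ))) ?_
      rw [← EReal.coe_finset_sum, ← EReal.coe_finset_sum, ← EReal.coe_add, ← EReal.coe_add,
        EReal.coe_le_coe_iff]
      simpa [Fintype.sum_option, Fintype.sum_sum_type, add_assoc] using hσα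
    exact EReal.sub_nonpos.2 hle
  · simpa [Fintype.sum_option, Fintype.sum_sum_type, add_assoc] using hY i

end

end StrongDuality

section WeakDuality

theorem EReal.ne_top_of_sum_ne_top {κ : Type*} (s : Finset κ) {f : κ → EReal}
    (hf : ∀ k, f k ≠ ⊥) : ∑ k ∈ s, f k ≠ ⊥ ∧ (∑ k ∈ s, f k ≠ ⊤ → ∀ k ∈ s, f k ≠ ⊤) := by
  induction s using Finset.cons_induction with
  | empty => simp
  | cons a s ha ih =>
    rw [Finset.sum_cons]
    refine ⟨by simp [EReal.add_eq_bot_iff, hf a, ih.1], fun h => ?_⟩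
    rw [EReal.add_ne_top_iff_ne_top₂ (hf a) ih.1] at h
    simpa using ⟨h.1, ih.2 h.2⟩

theorem EReal.exists_coe_of_sum_le {κ : Type*} [Fintype κ] {f : κ → EReal} (hf : ∀ k, f k ≠ ⊥)
    {α : ℝ} (h : ∑ k, f k ≤ α) : ∃ ρ : κ → ℝ, (∀ k, f k = ρ k) ∧ ∑ k, ρ k ≤ α := by
  have htop := (EReal.ne_top_of_sum_ne_top Finset.univ hf).2
    (h.trans_lt (EReal.coe_lt_top α)).ne
  have hρ : ∀ k, f k = ((f k).toReal : EReal) := fun k =>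
    (EReal.coe_toReal (htop k (Finset.mem_univ k)) (hf k)).symm
  refine ⟨fun k => (f k).toReal, hρ, ?_⟩
  rw [Finset.sum_congr rfl fun k _ => hρ k, ← EReal.coe_finset_sum] at h
  exact_mod_cast h

theorem cpersp_eq_neg_persp {n : ℕ} (g : (Fin n → ℝ) → EReal) (v : Fin n → ℝ) (l : ℝ) :
    cpersp g v l = - persp (fun z => - g z) v l := by
  rw [cpersp, persp]
  split_ifs with hl
  · rw [mul_neg, neg_neg]
  · rfl

theorem persp_one {n : ℕ} (F : (Fin n → ℝ) → EReal) (v : Fin n → ℝ) : persp F v 1 = F v := by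
  simp [persp]

theorem persp_smul_le {n : ℕ} {F : (Fin n → ℝ) → EReal} {z : Fin n → ℝ} {f : ℝ} (hf : F z ≤ f)
    {l : ℝ} (hl : 0 ≤ l) : persp F (l • z) l ≤ ((l * f : ℝ) : EReal) := by
  rcases hl.eq_or_lt with rfl | hl
  · rw [persp, if_neg (lt_irrefl _)]
    refine iSup₂_le fun x _ => ?_
    simp [dotp]
  · rw [persp, if_pos hl, smul_smul, inv_mul_cancel₀ hl.ne', one_smul, EReal.coe_mul]
    exact mul_le_mul_of_nonneg_left hf (by exact_mod_cast hl.le)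

/-- Fenchel's inequality for perspectives. -/
theorem dotp_sub_le_of_persp_le {n : ℕ} {F : (Fin n → ℝ) → EReal} {x₀ : Fin n → ℝ}
    (hx₀ : F x₀ < ⊤) {v y : Fin n → ℝ} {l ω b ρ : ℝ} (hl : 0 ≤ l) (hb : 0 ≤ b)
    (hv : persp F v l ≤ ω) (hy : persp (conjFn F) y b ≤ ρ) : dotp y v - b * ω ≤ l * ρ := by
  rcases hl.eq_or_lt with rfl | hl
  · rw [persp, if_neg (lt_irrefl _)] at hv
    rw [zero_mul, sub_nonpos]
    exact suppFn_conjFn_le hx₀ hv hb (hy.trans_lt (EReal.coe_lt_top ρ))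
  · rw [persp, if_pos hl, ← EReal.sub_nonpos, EReal.coe_mul_sub_nonpos_iff hl] at hv
    have h1 := (sub_le_persp_conjFn y _ hb hv).trans hy
    have h1 : dotp y (l⁻¹ • v) - b * (ω / l) ≤ ρ := by exact_mod_cast h1
    have h2 := mul_le_mul_of_nonneg_left h1 hl.le
    rw [dotp_smul_right, mul_sub, mul_inv_cancel_left₀ hl.ne'] at h2
    have h3 : l * (b * (ω / l)) = b * ω := by field_simp
    linarith

variable {gi : Fin I → (Fin dz → ℝ) → EReal} {c : Fin L → (Fin dz → ℝ) → EReal}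
  {h : Fin J → (Fin dz → ℝ) → EReal} {μ : Fin J → ℝ}

theorem blockFn_lt_top_of_mem_SbarI {i : Fin I} {z : Fin dz → ℝ} (hz : z ∈ SbarI gi c h i)
    (k : Option (Fin J ⊕ Fin L)) : blockFn gi c h i k z < ⊤ := by
  rcases k with _ | j | ℓ
  · refine lt_top_iff_ne_top.2 fun htop => hz.2.2.ne' ?_
    exact EReal.neg_eq_top_iff.1 htop
  · exact hz.2.1 j
  · exact (hz.1 ℓ).trans_lt (by simp)

theorem block_weak_duality (hS : AssumptionS gi c h)
    {q : ℝ × (Fin J → ℝ) × (Fin I → Fin dz → ℝ) × (Fin I → Fin J → Fin dz → ℝ) ×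
      (Fin I → Fin L → Fin dz → ℝ) × (Fin I → Fin L → ℝ)} (hq : q ∈ apwpFeas gi c h) (i : Fin I)
    {v : Fin dz → ℝ} {l t : ℝ} {w : Fin J → ℝ} (hl : 0 ≤ l)
    (hg : persp (fun z => - gi i z) v l ≤ ((-t : ℝ) : EReal)) (hh : ∀ j, persp (h j) v l ≤ w j)
    (hc : ∀ ℓ, persp (c ℓ) v l ≤ 0) : t - dotp w q.2.1 ≤ l * q.1 := by
  obtain ⟨hcon, hsum, hβ, hν⟩ := hq
  obtain ⟨z₀, hz₀⟩ := hS i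
  have hcon := hcon i
  let Y : Option (Fin J ⊕ Fin L) → Fin dz → ℝ := fun k =>
    k.elim (q.2.2.1 i) (Sum.elim (q.2.2.2.1 i) (q.2.2.2.2.1 i))
  let W := lagWeight q.2.1 (q.2.2.2.2.2 i)
  let ω : Option (Fin J ⊕ Fin L) → ℝ := fun k => k.elim (-t) (Sum.elim w 0)
  have hW : ∀ k, 0 ≤ W k := by
    rintro (_ | j | ℓ)
    exacts [zero_le_one, hβ j, hν i ℓ]
  have hY : ∑ k, Y k = 0 := by
    simpa [Fintype.sum_option, Fintype.sum_sum_type, add_assoc, Y] using hsum i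
  have hz₀' := blockFn_lt_top_of_mem_SbarI hz₀
  have hbot : ∀ k, persp (conjFn (blockFn gi c h i k)) (Y k) (W k) ≠ ⊥ := by
    intro k
    obtain ⟨f, hf, -⟩ := EReal.lt_iff_exists_real_btwn.1 (hz₀' k)
    exact ((EReal.bot_lt_coe _).trans_le (sub_le_persp_conjFn (Y k) z₀ (hW k) hf.le)).ne'
  have hle : ∑ k, persp (conjFn (blockFn gi c h i k)) (Y k) (W k) ≤ (q.1 : EReal) := by
    rw [apwpCon, EReal.sub_nonpos, add_assoc] at hcon
    rw [Fintype.sum_option, Fintype.sum_sum_type]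
    exact (congrArg (· + _) (persp_one _ _)).trans_le hcon
  obtain ⟨ρ, hρ, hρα⟩ := EReal.exists_coe_of_sum_le hbot hle
  have hω : ∀ k, persp (blockFn gi c h i k) v l ≤ (ω k : EReal) := by
    rintro (_ | j | ℓ)
    exacts [hg, hh j, hc ℓ]
  have key := Finset.sum_le_sum fun k (_ : k ∈ Finset.univ) =>
    dotp_sub_le_of_persp_le (hz₀' k) hl (hW k) (hω k) (hρ k).le
  rw [Finset.sum_sub_distrib, ← dotp_sum_left, hY, ← Finset.mul_sum] at key
  have h0 : dotp (0 : Fin dz → ℝ) v = 0 := by simp [dotp]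
  have hWω : ∑ k, W k * ω k = -t + dotp w q.2.1 := by
    simp [Fintype.sum_option, Fintype.sum_sum_type, W, ω, lagWeight, dotp, mul_comm]
  have := mul_le_mul_of_nonneg_left hρα hl
  linarith

theorem mem_apwFeas_of_mem_apwpFeas (hS : AssumptionS gi c h)
    {q : ℝ × (Fin J → ℝ) × (Fin I → Fin dz → ℝ) × (Fin I → Fin J → Fin dz → ℝ) ×
      (Fin I → Fin L → Fin dz → ℝ) × (Fin I → Fin L → ℝ)} (hq : q ∈ apwpFeas gi c h) :
    (q.1, q.2.1) ∈ apwFeas gi c h := by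
  refine ⟨hq.2.2.1, fun i p hp => ?_⟩
  have h1 := block_weak_duality hS hq i (v := p.1) (t := p.2.2) (w := p.2.1) zero_le_one
    (by simpa [persp_one] using hp.2.2) (fun j => by simpa [persp_one] using hp.2.1 j)
    (fun ℓ => by simpa [persp_one] using hp.1 ℓ)
  change p.2.2 - q.1 - dotp p.2.1 q.2.1 ≤ 0
  linarith

theorem apwVal_le_apwpVal (hS : AssumptionS gi c h) : apwVal gi c h μ ≤ apwpVal gi c h μ :=
  le_iInf₂ fun q hq => iInf₂_le (q.1, q.2.1) (mem_apwFeas_of_mem_apwpFeas hS hq)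

theorem adbpVal_le_apwpVal (hS : AssumptionS gi c h) :
    adbpVal gi c h μ ≤ apwpVal gi c h μ := by
  refine iSup₂_le fun r hr => le_iInf₂ fun q hq => ?_
  obtain ⟨hl1, hωμ, hl, hC, hH, hG⟩ := hr
  have h1 : ∀ i, r.1 i - dotp (r.2.2.1 i) q.2.1 ≤ r.2.1 i * q.1 := by
    intro i
    refine block_weak_duality hS hq i (hl i) ?_ (fun j => ?_) (hC i)
    · have := hG i
      rw [adbpConG, EReal.sub_nonpos, cpersp_eq_neg_persp] at this
      rw [EReal.coe_neg]
      exact EReal.le_neg_of_le_neg this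
    · have := hH i j
      rwa [adbpConH, EReal.sub_nonpos] at this
  have h2 := Finset.sum_le_sum fun i (_ : i ∈ Finset.univ) => h1 i
  rw [Finset.sum_sub_distrib, ← Finset.sum_mul, hl1, one_mul, ← dotp_sum_left] at h2
  have h3 : dotp (∑ i, r.2.2.1 i) q.2.1 ≤ dotp μ q.2.1 :=
    Finset.sum_le_sum fun j _ => mul_le_mul_of_nonneg_right
      (by simpa using hωμ j) (hq.2.2.1 j)
  exact_mod_cast (by linarith : ∑ i, r.1 i ≤ q.1 + dotp μ q.2.1)

theorem adbVal_le_adbpVal : adbVal gi c h μ ≤ adbpVal gi c h μ := by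
  refine iSup₂_le fun p hp => ?_
  obtain ⟨hU, hl, hl1, hμ⟩ := hp
  refine le_iSup₂_of_le (fun i => p.2 i * (p.1 i).2.2, p.2, fun i j => p.2 i * (p.1 i).2.1 j,
    fun i => p.2 i • (p.1 i).1) ⟨hl1, hμ, hl, fun i ℓ => ?_, fun i j => ?_, fun i => ?_⟩ le_rfl
  · have := persp_smul_le (F := c ℓ) (f := 0) (by exact_mod_cast (hU i).1 ℓ) (hl i)
    simpa [adbpConC] using this
  · rw [adbpConH, EReal.sub_nonpos]
    exact persp_smul_le ((hU i).2.1 j) (hl i)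
  · rw [adbpConG, EReal.sub_nonpos, cpersp_eq_neg_persp]
    have h1 := persp_smul_le (F := fun z => - gi i z) (z := (p.1 i).1) (f := -(p.1 i).2.2)
      (by rw [EReal.coe_neg]; exact EReal.neg_le_neg_iff.2 (hU i).2.2) (hl i)
    refine EReal.le_neg_of_le_neg ?_
    rwa [mul_neg, EReal.coe_neg] at h1

theorem apwFeas_subset_duqFeas (hG : AssumptionG gi) (hH : AssumptionH h) :
    apwFeas gi c h ⊆ duqFeas gi c h := by
  rintro p ⟨hβ, hp⟩
  refine ⟨hβ, fun z hz => iSup_le fun i => ?_⟩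
  obtain ⟨i', hz⟩ := Set.mem_iUnion.1 hz
  have hu : ∀ j, h j z = ((h j z).toReal : EReal) := fun j =>
    (EReal.coe_toReal (hz.2.1 j).ne ((hH j).1.1 z)).symm
  rw [Finset.sum_congr rfl fun j _ => by rw [hu j, ← EReal.coe_mul], ← EReal.coe_finset_sum,
    ← EReal.coe_add]
  induction hg : gi i z with
  | bot => exact bot_le
  | top => exact absurd (by simp [hg]) ((hG i).1.1 z)
  | coe t =>
    have := hp i (z, fun j => (h j z).toReal, t) ⟨hz.1, fun j => (hu j).le, hg.ge⟩
    rw [EReal.coe_le_coe_iff]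
    simp only [dotp, mul_comm] at this ⊢
    linarith

theorem duqVal_le_apwVal (hG : AssumptionG gi) (hH : AssumptionH h) :
    duqVal gi c h μ ≤ apwVal gi c h μ :=
  le_iInf₂ fun p hp => iInf₂_le p (apwFeas_subset_duqFeas hG hH hp)

theorem adbVal_le_frVal : adbVal gi c h μ ≤ frVal gi c h μ := by
  refine iSup₂_le fun p hp => ?_
  obtain ⟨hU, hl, hl1, hμ⟩ := hp
  have hl' : ∀ i, (0 : EReal) ≤ (p.2 i : EReal) := fun i => by exact_mod_cast hl i
  have hobj : ((∑ i, p.2 i * (p.1 i).2.2 : ℝ) : EReal) ≤ frObj gi (fun i => (p.1 i).1, p.2) := by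
    rw [EReal.coe_finset_sum]
    refine Finset.sum_le_sum fun i _ => ?_
    rw [EReal.coe_mul]
    exact mul_le_mul_of_nonneg_left ((hU i).2.2.trans (le_iSup (fun k => gi k (p.1 i).1) i)) (hl' i)
  refine le_iSup₂_of_le (fun i => (p.1 i).1, p.2) ⟨fun i => Set.mem_iUnion.2 ⟨i, (hU i).1,
    fun j => ((hU i).2.1 j).trans_lt (EReal.coe_lt_top _),
    (EReal.bot_lt_coe _).trans_le (hU i).2.2⟩, hl, hl1, fun j => ?_,
    ((EReal.bot_lt_coe _).trans_le hobj).ne'⟩ hobj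
  refine le_trans (Finset.sum_le_sum fun i _ => mul_le_mul_of_nonneg_left ((hU i).2.1 j) (hl' i)) ?_
  simp only [← EReal.coe_mul]
  rw [← EReal.coe_finset_sum]
  exact_mod_cast hμ j

end WeakDuality

section Expectations

variable {n : ℕ}

theorem epos_coe (a : ℝ) : epos (a : EReal) = ENNReal.ofReal a := by
  rw [epos, if_neg (EReal.coe_ne_top a), EReal.toReal_coe]

theorem measurable_epos : Measurable epos :=
  Measurable.ite (measurableSet_singleton _) measurable_const
    measurable_ereal_toReal.ennreal_ofReal

theorem lowExp_eq_coe_integral {P : Measure (Fin n → ℝ)} {f : (Fin n → ℝ) → EReal}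
    {g : (Fin n → ℝ) → ℝ} (hfg : ∀ᵐ z ∂P, f z = g z) (hg : Integrable g P) :
    lowExp P f = ((∫ z, g z ∂P : ℝ) : EReal) := by
  have h1 : ∫⁻ z, epos (f z) ∂P = ∫⁻ z, ENNReal.ofReal (g z) ∂P :=
    lintegral_congr_ae (hfg.mono fun z hz => by simp only [hz, epos_coe])
  have h2 : ∫⁻ z, epos (-(f z)) ∂P = ∫⁻ z, ENNReal.ofReal (-(g z)) ∂P :=
    lintegral_congr_ae (hfg.mono fun z hz => by simp only [hz, ← EReal.coe_neg, epos_coe])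
  have t1 : ∫⁻ z, ENNReal.ofReal (g z) ∂P ≠ ⊤ := hg.lintegral_lt_top.ne
  have t2 : ∫⁻ z, ENNReal.ofReal (-(g z)) ∂P ≠ ⊤ := hg.neg.lintegral_lt_top.ne
  rw [lowExp, h1, h2, integral_eq_lintegral_pos_part_sub_lintegral_neg_part hg, EReal.coe_sub,
    ← EReal.coe_ennreal_toReal t1, ← EReal.coe_ennreal_toReal t2]

theorem highExp_eq_coe_integral {P : Measure (Fin n → ℝ)} {f : (Fin n → ℝ) → EReal}
    {g : (Fin n → ℝ) → ℝ} (hfg : ∀ᵐ z ∂P, f z = g z) (hg : Integrable g P) :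
    highExp P f = ((∫ z, g z ∂P : ℝ) : EReal) := by
  rw [highExp, lowExp_eq_coe_integral (g := fun z => - g z)
    (hfg.mono fun z hz => by rw [hz, EReal.coe_neg]) hg.neg, integral_neg, EReal.coe_neg, neg_neg]

theorem lintegral_epos_neg_ne_top_of_lowExp_ne_bot {P : Measure (Fin n → ℝ)}
    {f : (Fin n → ℝ) → EReal} (hf : lowExp P f ≠ ⊥) : ∫⁻ z, epos (-(f z)) ∂P ≠ ⊤ := by
  intro h
  refine hf ?_
  rw [lowExp, h]
  simp

theorem ae_lt_top_of_lintegral_epos_ne_top {P : Measure (Fin n → ℝ)} {f : (Fin n → ℝ) → EReal}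
    (hfm : Measurable f) (hf : ∫⁻ z, epos (f z) ∂P ≠ ⊤) : ∀ᵐ z ∂P, f z < ⊤ := by
  filter_upwards [ae_lt_top (measurable_epos.comp hfm) hf] with z hz
  refine lt_top_iff_ne_top.2 fun htop => hz.ne ?_
  simp [epos, htop]

theorem integrable_posPart_of_lintegral_epos_ne_top {P : Measure (Fin n → ℝ)}
    {f : (Fin n → ℝ) → EReal} {g : (Fin n → ℝ) → ℝ} (hfg : ∀ᵐ z ∂P, f z = g z)
    (hgm : Measurable g) (hf : ∫⁻ z, epos (f z) ∂P ≠ ⊤) :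
    Integrable (fun z => max (g z) 0) P := by
  rw [← lintegral_ofReal_ne_top_iff_integrable (by fun_prop)
    (Filter.Eventually.of_forall fun z => le_max_right (g z) 0)]
  convert hf using 1
  refine lintegral_congr_ae (hfg.mono fun z hz => ?_)
  simp [hz, epos_coe]

theorem isClosed_Sset {c : Fin L → (Fin dz → ℝ) → EReal} (hC : AssumptionC c) :
    IsClosed (Sset c) := by
  have : Sset c = ⋂ ℓ, c ℓ ⁻¹' Set.Iic 0 := by
    ext z
    simp [Sset]
  rw [this]
  exact isClosed_iInter fun ℓ => (hC ℓ).2.1.1.isClosed_preimage 0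

variable {gi : Fin I → (Fin dz → ℝ) → EReal} {c : Fin L → (Fin dz → ℝ) → EReal}
  {h : Fin J → (Fin dz → ℝ) → EReal} {μ : Fin J → ℝ}

theorem gFun_lt_top (hG : AssumptionG gi) (z : Fin dz → ℝ) : gFun gi z < ⊤ := by
  have h1 : ∀ i, gi i z < ⊤ := fun i => lt_top_iff_ne_top.2 fun htop =>
    (hG i).1.1 z (by simp [htop])
  rcases isEmpty_or_nonempty (Fin I) with hI | hI
  · simp [gFun]
  · obtain ⟨i, hi⟩ := exists_eq_ciSup_of_finite (f := fun i => gi i z)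
    rw [gFun, ← hi]
    exact h1 i

theorem puqVal_le_duqVal (hG : AssumptionG gi) (hC : AssumptionC c) (hH : AssumptionH h)
    (hmg : ∀ i, Measurable (gi i)) (hmh : ∀ j, Measurable (h j)) :
    puqVal gi c h μ ≤ duqVal gi c h μ := by
  refine iSup₂_le fun P hP => le_iInf₂ fun p hp => ?_
  obtain ⟨⟨hprob, hPS, hmom⟩, hlow⟩ := hP
  obtain ⟨hβ, hp⟩ := hp
  have hmgF : Measurable (gFun gi) := Measurable.iSup hmg
  let gr : (Fin dz → ℝ) → ℝ := fun z => (gFun gi z).toReal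
  let hr : Fin J → (Fin dz → ℝ) → ℝ := fun j z => (h j z).toReal
  have hgrm : Measurable gr := measurable_ereal_toReal.comp hmgF
  have hhrm : ∀ j, Measurable (hr j) := fun j => measurable_ereal_toReal.comp (hmh j)
  have hG' := lintegral_epos_neg_ne_top_of_lowExp_ne_bot hlow
  have hH' : ∀ j, ∫⁻ z, epos (h j z) ∂P ≠ ⊤ := by
    intro j
    have hne : lowExp P (fun z => - h j z) ≠ ⊥ := by
      intro hbot
      have := hmom j
      simp [highExp, hbot] at this
    simpa using lintegral_epos_neg_ne_top_of_lowExp_ne_bot hne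
  have hSae : ∀ᵐ z ∂P, z ∈ Sset c :=
    (prob_compl_eq_zero_iff (isClosed_Sset hC).measurableSet).2 hPS
  have hgae : ∀ᵐ z ∂P, gFun gi z = (gr z : EReal) := by
    filter_upwards [ae_lt_top_of_lintegral_epos_ne_top hmgF.neg hG'] with z hz
    refine (EReal.coe_toReal (gFun_lt_top hG z).ne fun hbot => ?_).symm
    simp [hbot] at hz
  have hhae : ∀ j, ∀ᵐ z ∂P, h j z = (hr j z : EReal) := fun j => by
    filter_upwards [ae_lt_top_of_lintegral_epos_ne_top (hmh j) (hH' j)] with z hz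
    exact (EReal.coe_toReal hz.ne ((hH j).1.1 z)).symm
  have hineq : ∀ᵐ z ∂P, gr z ≤ p.1 + ∑ j, p.2 j * hr j z := by
    filter_upwards [hSae, hgae, ae_all_iff.2 hhae] with z hzS hzg hzh
    have hz : z ∈ Sbar gi c h := by
      have : ⊥ < gFun gi z := by rw [hzg]; exact EReal.bot_lt_coe _
      obtain ⟨i, hi⟩ := lt_iSup_iff.1 this
      exact Set.mem_iUnion.2 ⟨i, hzS, fun j => by rw [hzh j]; exact EReal.coe_lt_top _, hi⟩
    have := hp z hz
    rw [hzg, Finset.sum_congr rfl fun j _ => by rw [hzh j, ← EReal.coe_mul],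
      ← EReal.coe_finset_sum, ← EReal.coe_add] at this
    exact_mod_cast this
  have hgneg : Integrable (fun z => max (-(gr z)) 0) P :=
    integrable_posPart_of_lintegral_epos_ne_top
      (hgae.mono fun z hz => by rw [hz, EReal.coe_neg]) hgrm.neg hG'
  have hhpos : ∀ j, Integrable (fun z => max (hr j z) 0) P := fun j =>
    integrable_posPart_of_lintegral_epos_ne_top (hhae j) (hhrm j) (hH' j)
  have hBint : Integrable (fun z => |p.1| + max (-(gr z)) 0 + ∑ j, p.2 j * max (hr j z) 0) P :=
    ((integrable_const _).add hgneg).add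
      (integrable_finsetSum _ fun j _ => (hhpos j).const_mul _)
  have hterm : ∀ j z, p.2 j * hr j z ≤ p.2 j * max (hr j z) 0 := fun j z =>
    mul_le_mul_of_nonneg_left (le_max_left _ _) (hβ j)
  have hterm0 : ∀ j z, 0 ≤ p.2 j * max (hr j z) 0 := fun j z =>
    mul_nonneg (hβ j) (le_max_right _ _)
  have hhint : ∀ j, Integrable (fun z => p.2 j * hr j z) P := by
    intro j
    refine hBint.mono' ((hhrm j).const_mul _).aestronglyMeasurable ?_
    filter_upwards [hineq] with z hz
    have h1 : ∑ k ∈ Finset.univ.erase j, p.2 k * hr k z ≤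
        ∑ k ∈ Finset.univ.erase j, p.2 k * max (hr k z) 0 :=
      Finset.sum_le_sum fun k _ => hterm k z
    have h2 : 0 ≤ ∑ k ∈ Finset.univ.erase j, p.2 k * max (hr k z) 0 :=
      Finset.sum_nonneg fun k _ => hterm0 k z
    have h3 := le_abs_self p.1
    have h4 := abs_nonneg p.1
    have h5 := le_max_left (-(gr z)) 0
    have h6 := le_max_right (-(gr z)) 0
    rw [← Finset.add_sum_erase _ _ (Finset.mem_univ j)] at hz ⊢
    rw [Real.norm_eq_abs, abs_le]
    constructor <;> linarith [hterm j z, hterm0 j z]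
  have hrhs : Integrable (fun z => p.1 + ∑ j, p.2 j * hr j z) P :=
    (integrable_const _).add (integrable_finsetSum _ fun j _ => hhint j)
  have hgint : Integrable gr P := by
    refine hBint.mono' hgrm.aestronglyMeasurable ?_
    filter_upwards [hineq] with z hz
    have h1 : ∑ k, p.2 k * hr k z ≤ ∑ k, p.2 k * max (hr k z) 0 :=
      Finset.sum_le_sum fun k _ => hterm k z
    have h2 : 0 ≤ ∑ k, p.2 k * max (hr k z) 0 := Finset.sum_nonneg fun k _ => hterm0 k z
    have h3 := le_abs_self p.1
    have h4 := abs_nonneg p.1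
    have h5 := le_max_left (-(gr z)) 0
    have h6 := le_max_right (-(gr z)) 0
    rw [Real.norm_eq_abs, abs_le]
    constructor <;> linarith
  rw [lowExp_eq_coe_integral hgae hgint, EReal.coe_le_coe_iff]
  have hmono := integral_mono_ae hgint hrhs hineq
  rw [integral_add (integrable_const _) (integrable_finsetSum _ fun j _ => hhint j),
    integral_finsetSum _ fun j _ => hhint j] at hmono
  simp only [integral_const, probReal_univ, one_smul] at hmono
  refine hmono.trans (add_le_add le_rfl (Finset.sum_le_sum fun j _ => ?_))
  rw [integral_const_mul, mul_comm (μ j)]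
  rcases (hβ j).eq_or_lt with h0 | h0
  · simp [← h0]
  · refine mul_le_mul_of_nonneg_left ?_ h0.le
    have hint : Integrable (hr j) P := by
      have := (hhint j).const_mul (p.2 j)⁻¹
      simpa [inv_mul_cancel_left₀ h0.ne'] using this
    have := hmom j
    rw [highExp_eq_coe_integral (hhae j) hint] at this
    exact_mod_cast this

theorem frVal_le_puqVal (hG : AssumptionG gi) (hH : AssumptionH h) :
    frVal gi c h μ ≤ puqVal gi c h μ := by
  refine iSup₂_le fun p hp => ?_
  obtain ⟨hz, hl, hl1, hμ, hne⟩ := hp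
  let P : Measure (Fin dz → ℝ) := ∑ i, ENNReal.ofReal (p.2 i) • Measure.dirac (p.1 i)
  have hPS : ∀ S : Set (Fin dz → ℝ), (∀ i, p.1 i ∈ S) → P S = 1 := by
    intro S hS
    simp only [P, Measure.coe_finsetSum, Finset.sum_apply, Measure.smul_apply,
      Measure.dirac_apply, smul_eq_mul]
    rw [Finset.sum_congr rfl fun i _ => by rw [Set.indicator_of_mem (hS i), Pi.one_apply, mul_one],
      ← ENNReal.ofReal_sum_of_nonneg fun i _ => hl i, hl1, ENNReal.ofReal_one]
  have hint : ∀ f : (Fin dz → ℝ) → ℝ, Integrable f P := fun f =>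
    integrable_finsetSum_measure.2 fun i _ =>
      (integrable_dirac (by simp)).smul_measure ENNReal.ofReal_ne_top
  have hval : ∀ f : (Fin dz → ℝ) → ℝ, ∫ z, f z ∂P = ∑ i, p.2 i * f (p.1 i) := by
    intro f
    rw [integral_finsetSum_measure fun i _ =>
      (integrable_dirac (by simp)).smul_measure ENNReal.ofReal_ne_top]
    refine Finset.sum_congr rfl fun i _ => ?_
    rw [integral_smul_measure, integral_dirac, ENNReal.toReal_ofReal (hl i), smul_eq_mul]
  have hae : ∀ {f : (Fin dz → ℝ) → EReal}, (∀ i, f (p.1 i) ≠ ⊤ ∧ f (p.1 i) ≠ ⊥) →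
      ∀ᵐ z ∂P, f z = ((f z).toReal : EReal) := by
    intro f hf
    simp only [P, ae_iff, Measure.coe_finsetSum, Finset.sum_apply, Measure.smul_apply,
      Measure.dirac_apply, smul_eq_mul]
    refine Finset.sum_eq_zero fun i _ => ?_
    simp [EReal.coe_toReal (hf i).1 (hf i).2]
  have hsum : ∀ {f : (Fin dz → ℝ) → EReal}, (∀ i, f (p.1 i) ≠ ⊤ ∧ f (p.1 i) ≠ ⊥) →
      ((∑ i, p.2 i * (f (p.1 i)).toReal : ℝ) : EReal) = ∑ i, (p.2 i : EReal) * f (p.1 i) := by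
    intro f hf
    rw [EReal.coe_finset_sum]
    refine Finset.sum_congr rfl fun i _ => ?_
    rw [EReal.coe_mul, EReal.coe_toReal (hf i).1 (hf i).2]
  have hgfin : ∀ i, gFun gi (p.1 i) ≠ ⊤ ∧ gFun gi (p.1 i) ≠ ⊥ := by
    intro i
    obtain ⟨i', hi'⟩ := Set.mem_iUnion.1 (hz i)
    exact ⟨(gFun_lt_top hG _).ne,
      (hi'.2.2.trans_le (le_iSup (fun k => gi k (p.1 i)) i')).ne'⟩
  have hhfin : ∀ j i, h j (p.1 i) ≠ ⊤ ∧ h j (p.1 i) ≠ ⊥ := by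
    intro j i
    obtain ⟨i', hi'⟩ := Set.mem_iUnion.1 (hz i)
    exact ⟨(hi'.2.1 j).ne, (hH j).1.1 _⟩
  have hobj : lowExp P (gFun gi) = frObj gi p := by
    rw [lowExp_eq_coe_integral (hae hgfin) (hint _), hval, hsum hgfin, frObj]
  refine le_iSup₂_of_le P ⟨⟨⟨hPS _ fun i => Set.mem_univ _⟩, hPS _ fun i => ?_, fun j => ?_⟩, ?_⟩
    hobj.ge
  · obtain ⟨i', hi'⟩ := Set.mem_iUnion.1 (hz i)
    exact hi'.1
  · rw [highExp_eq_coe_integral (hae (hhfin j)) (hint _), hval, hsum (hhfin j)]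
    exact hμ j
  · rwa [hobj]

end Expectations

/-- **Strong duality for uncertainty quantification under a dual-side Slater
condition** (Theorem 4.2 (i)): under assumptions (G), (C), (H) and (S), if (AD-B')
admits a Slater point with `λ > 0`, then (AP-W'), (AP-W), (D-UQ), (P-UQ), (FR), (AD-B)
and (AD-B') all have the same optimal value and (AP-W') is solvable; moreover, every
optimal solution of (AP-W') yields an optimal solution `(α*, β*)` of (D-UQ). -/
theorem uq_strong_duality_dual_side (dz I J L : ℕ)
    (gi : Fin I → (Fin dz → ℝ) → EReal) (c : Fin L → (Fin dz → ℝ) → EReal)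
    (h : Fin J → (Fin dz → ℝ) → EReal) (μ : Fin J → ℝ)
    (hG : AssumptionG gi) (hC : AssumptionC c) (hH : AssumptionH h)
    (hS : AssumptionS gi c h) (hSne : (Sset c).Nonempty)
    (hmg : ∀ i, Measurable (gi i)) (hmh : ∀ j, Measurable (h j))
    (hSlater : ∃ r, SlaterADBP gi c h μ r ∧ ∀ i, 0 < r.2.1 i) :
    apwpVal gi c h μ = apwVal gi c h μ ∧
    apwVal gi c h μ = duqVal gi c h μ ∧
    duqVal gi c h μ = puqVal gi c h μ ∧
    puqVal gi c h μ = frVal gi c h μ ∧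
    frVal gi c h μ = adbVal gi c h μ ∧
    adbVal gi c h μ = adbpVal gi c h μ ∧
    apwpSolvable gi c h μ ∧
    (∀ q ∈ apwpFeas gi c h, ((q.1 + dotp μ q.2.1 : ℝ) : EReal) = apwpVal gi c h μ →
      (q.1, q.2.1) ∈ duqFeas gi c h ∧
      ((q.1 + dotp μ q.2.1 : ℝ) : EReal) = duqVal gi c h μ) := by
  obtain ⟨r, hr, hpos⟩ := hSlater
  have h1 : adbVal gi c h μ ≤ frVal gi c h μ := adbVal_le_frVal
  have h2 : frVal gi c h μ ≤ puqVal gi c h μ := frVal_le_puqVal hG hH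
  have h3 : puqVal gi c h μ ≤ duqVal gi c h μ := puqVal_le_duqVal hG hC hH hmg hmh
  have h4 : duqVal gi c h μ ≤ apwVal gi c h μ := duqVal_le_apwVal hG hH
  have h5 : apwVal gi c h μ ≤ apwpVal gi c h μ := apwVal_le_apwpVal hS
  have h6 : adbVal gi c h μ ≤ adbpVal gi c h μ := adbVal_le_adbpVal
  have h7 : adbpVal gi c h μ ≤ apwpVal gi c h μ := adbpVal_le_apwpVal hS
  obtain ⟨p₀, hp₀⟩ := adbFeas_nonempty hr hpos
  have hstrong : apwpVal gi c h μ ≤ adbVal gi c h μ ∧ apwpSolvable gi c h μ := by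
    have hle : ∀ p ∈ adbFeas gi c h μ,
        ((∑ i, p.2 i * (p.1 i).2.2 : ℝ) : EReal) ≤ adbVal gi c h μ := fun p hp =>
      le_iSup₂ (f := fun p (_ : p ∈ adbFeas gi c h μ) =>
        ((∑ i, p.2 i * (p.1 i).2.2 : ℝ) : EReal)) p hp
    have hle' : ∀ q ∈ apwpFeas gi c h,
        apwpVal gi c h μ ≤ ((q.1 + dotp μ q.2.1 : ℝ) : EReal) := fun q hq =>
      iInf₂_le (f := fun q (_ : q ∈ apwpFeas gi c h) =>
        ((q.1 + dotp μ q.2.1 : ℝ) : EReal)) q hq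
    induction hV : adbVal gi c h μ with
    | bot => exact absurd (hle p₀ hp₀) (by simp [hV])
    | top =>
      refine ⟨le_top, Or.inl (Set.eq_empty_iff_forall_notMem.2 fun q hq => ?_)⟩
      have := (h6.trans h7).trans (hle' q hq)
      rw [hV] at this; exact absurd this (not_le.2 (EReal.coe_lt_top _))
    | coe V =>
      obtain ⟨q, hq, hqV⟩ := exists_mem_apwpFeas_of_adb_le hG hC hH hr hpos (V := V)
        fun p hp => by
          have := hle p hp
          rw [hV] at this
          exact_mod_cast this
      have hqV : ((q.1 + dotp μ q.2.1 : ℝ) : EReal) ≤ V := by exact_mod_cast hqV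
      refine ⟨(hle' q hq).trans hqV, Or.inr ⟨q, hq, le_antisymm ?_ (hle' q hq)⟩⟩
      exact (hqV.trans hV.ge).trans (h6.trans h7)
  obtain ⟨h8, hsolv⟩ := hstrong
  have e1 : apwpVal gi c h μ = duqVal gi c h μ :=
    le_antisymm (h8.trans (h1.trans (h2.trans h3))) (h4.trans h5)
  exact ⟨le_antisymm (e1.le.trans h4) h5,
    le_antisymm (h5.trans e1.le) h4,
    le_antisymm (e1.ge.trans (h8.trans (h1.trans h2))) h3,
    le_antisymm ((h3.trans e1.ge).trans (h8.trans h1)) h2,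
    le_antisymm ((h2.trans (h3.trans e1.ge)).trans h8) h1,
    le_antisymm h6 (h7.trans h8), hsolv, fun q hq hqv =>
      ⟨apwFeas_subset_duqFeas hG hH (mem_apwFeas_of_mem_apwpFeas hS hq), hqv.trans e1⟩⟩
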